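/- Let ε ∈ (0, 1/1000). There is a constant C_ε > 0 such that for all x ≥ 2, all primes q with x^{51/114+ε} ≤ q ≤ x^{1−ε}, and all quadratic nonresidues α modulo q, one has (1/φ(q)) · ∑_{ℓ ∈ (ℤ/qℤ)^×} | (1/2)·∑_{(n,c): x < nc⁶ ≤ 2x, nc⁶ ≡ ℓ or αℓ (mod q)} μ(c)·r(n) − (1/φ(q))·∑_{(n,c): x < nc⁶ ≤ 2x, gcd(nc⁶, q)=1} μ(c)·r(n) |² ≤ C_ε · (x/q)^{1/6 − ε/16}. -/

import Mathlib

open MeasureTheory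
open scoped Classical

/-- Real value of the Riemann zeta function at a real point. -/
noncomputable def zr (s : ℝ) : ℝ := (riemannZeta (s : ℂ)).re

/-- The smooth approximant `f(u) = ζ(3/2)/(2 u^{1/2}) + ζ(2/3)/(3 u^{2/3})`. -/
noncomputable def fm (u : ℝ) : ℝ :=
  zr (3/2) / (2 * u ^ ((1:ℝ)/2)) + zr (2/3) / (3 * u ^ ((2:ℝ)/3))

/-- `W(y) = ∫_1^2 f(u) e^{-2π i u y} du`. -/
noncomputable def Wf (y : ℝ) : ℂ :=
  ∫ u in (1:ℝ)..2, (fm u : ℂ) * Complex.exp (((-2 * Real.pi * u * y : ℝ) : ℂ) * Complex.I)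

/-- The constant `C = (ζ(11/6)/2) ∏_p (1 - p⁻² + 2p⁻⁶ + 2p⁻⁷) ∫_0^∞ |W(y)|² y^{5/6} dy`. -/
noncomputable def Cmain : ℝ :=
  (zr (11/6) / 2) *
    (∏' p : Nat.Primes, (1 - 1/((p:ℕ):ℝ)^2 + 2/((p:ℕ):ℝ)^6 + 2/((p:ℕ):ℝ)^7)) *
    ∫ y in Set.Ioi (0:ℝ), ‖Wf y‖^2 * y ^ ((5:ℝ)/6)

/-- Indicator function of integers of the form `a^2 * b^3` with `a b` positive. -/
noncomputable def ind23 (n : ℕ) : ℝ :=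
  if ∃ a b : ℕ, 0 < a ∧ 0 < b ∧ n = a ^ 2 * b ^ 3 then 1 else 0

/-- The residual term `r(n) = 1_{2,3}(n) - f(n)`. -/
noncomputable def rf (n : ℕ) : ℝ := ind23 n - fm n

/-- `∑_{(n,c) : x < n c⁶ ≤ 2x, n c⁶ ≡ a (mod q)} μ(c) r(n)`. -/
noncomputable def Spr (x : ℝ) (q : ℕ) (a : ZMod q) : ℝ :=
  ∑ n ∈ Finset.Icc 1 ⌊2*x⌋₊, ∑ c ∈ Finset.Icc 1 ⌊2*x⌋₊,
    if x < ((n * c^6 : ℕ) : ℝ) ∧ ((n * c^6 : ℕ) : ℝ) ≤ 2*x ∧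
        ((n * c^6 : ℕ) : ZMod q) = a
    then ((ArithmeticFunction.moebius c : ℤ) : ℝ) * rf n else 0

/-- `∑_{(n,c) : x < n c⁶ ≤ 2x, gcd(n c⁶, q) = 1} μ(c) r(n)`. -/
noncomputable def SprCop (x : ℝ) (q : ℕ) : ℝ :=
  ∑ n ∈ Finset.Icc 1 ⌊2*x⌋₊, ∑ c ∈ Finset.Icc 1 ⌊2*x⌋₊,
    if x < ((n * c^6 : ℕ) : ℝ) ∧ ((n * c^6 : ℕ) : ℝ) ≤ 2*x ∧
        Nat.Coprime (n * c^6) q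
    then ((ArithmeticFunction.moebius c : ℤ) : ℝ) * rf n else 0

section TwistedDeviation

variable {G : Type*} [CommGroup G] [Fintype G]

/-- The deviation from its mean of the average of a function and of its translate by `α`. -/
noncomputable def twistDev (α : G) : (G → ℝ) →ₗ[ℝ] EuclideanSpace ℝ G where
  toFun F := WithLp.toLp 2 fun t => (F t + F (α * t)) / 2 - (∑ s, F s) / Fintype.card G
  map_add' F H := by
    ext t
    simp only [Pi.add_apply, Finset.sum_add_distrib, PiLp.add_apply]
    ring
  map_smul' r F := by
    ext t
    simp only [Pi.smul_apply, smul_eq_mul, ← Finset.mul_sum, PiLp.smul_apply, RingHom.id_apply]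
    ring

theorem norm_twistDev_sq (α : G) (F : G → ℝ) :
    ‖twistDev α F‖ ^ 2 =
      ∑ t, ((F t + F (α * t)) / 2 - (∑ s, F s) / Fintype.card G) ^ 2 := by
  simp [EuclideanSpace.real_norm_sq_eq, twistDev]

theorem sum_mul_left_translate (α : G) (F : G → ℝ) : ∑ t, F (α * t) = ∑ t, F t :=
  Equiv.sum_comp (Equiv.mulLeft α) F

theorem norm_twistDev_sq_le_of_average (α : G) (F : G → ℝ) (κ : ℝ) :
    ‖twistDev α F‖ ^ 2 ≤ ∑ t, ((F t + F (α * t)) / 2 - κ) ^ 2 := by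
  rw [norm_twistDev_sq]
  set N : ℝ := (Fintype.card G : ℝ) with hN
  have hN0 : N ≠ 0 := by
    rw [hN]; exact_mod_cast Fintype.card_ne_zero
  set m := (∑ s, F s) / N with hm
  have hsum : ∑ t, ((F t + F (α * t)) / 2 - m) = 0 := by
    rw [Finset.sum_sub_distrib, ← Finset.sum_div, Finset.sum_add_distrib, sum_mul_left_translate]
    simp only [Finset.sum_const, Finset.card_univ, nsmul_eq_mul, ← hN]
    rw [hm]; field_simp; ring
  have hexp : ∑ t, ((F t + F (α * t)) / 2 - κ) ^ 2 =
      ∑ t, ((F t + F (α * t)) / 2 - m) ^ 2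
        + 2 * (m - κ) * ∑ t, ((F t + F (α * t)) / 2 - m) + N * (m - κ) ^ 2 := by
    rw [Finset.mul_sum, ← Finset.sum_add_distrib, hN, ← nsmul_eq_mul, ← Finset.card_univ,
      ← Finset.sum_const, ← Finset.sum_add_distrib]
    exact Finset.sum_congr rfl fun t _ => by ring
  rw [hexp, hsum]
  have : 0 ≤ N * (m - κ) ^ 2 := by positivity
  linarith

theorem norm_twistDev_sq_le (α : G) (F : G → ℝ) (κ : ℝ) :
    ‖twistDev α F‖ ^ 2 ≤ ∑ t, (F t - κ) ^ 2 := by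
  refine (norm_twistDev_sq_le_of_average α F κ).trans ?_
  have h : ∑ t, ((F t + F (α * t)) / 2 - κ) ^ 2 ≤
      ∑ t, ((F t - κ) ^ 2 + (F (α * t) - κ) ^ 2) / 2 :=
    Finset.sum_le_sum fun t _ => by nlinarith [sq_nonneg (F t - F (α * t))]
  refine h.trans (le_of_eq ?_)
  rw [← Finset.sum_div, Finset.sum_add_distrib, sum_mul_left_translate α fun t => (F t - κ) ^ 2]
  ring

end TwistedDeviation

section Progressions

/-- The sum of `w` over the integers of `(u, v]` in a residue class modulo `q`. -/
noncomputable def progSum (q u v : ℕ) (w : ℕ → ℝ) (t : ZMod q) : ℝ :=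
  ∑ n ∈ (Finset.Ioc u v).filter fun n : ℕ => (n : ZMod q) = t, w n

theorem card_residue_le_one {q : ℕ} {u d : ℕ} (hd : d ≤ q) (s : Finset ℕ) (t : ZMod q)
    (hs : ∀ n ∈ s, u < n ∧ n ≤ u + d ∧ (n : ZMod q) = t) : s.card ≤ 1 := by
  rw [Finset.card_le_one]
  intro a ha b hb
  obtain ⟨h1, h2, h3⟩ := hs a ha
  obtain ⟨h4, h5, h6⟩ := hs b hb
  have h : a ≡ b [MOD q] := (ZMod.natCast_eq_natCast_iff _ _ _).1 (h3.trans h6.symm)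
  rcases le_total a b with hab | hab
  · have := (Nat.modEq_iff_dvd' hab).1 h
    have := Nat.eq_zero_of_dvd_of_lt this (by omega)
    omega
  · have := (Nat.modEq_iff_dvd' hab).1 h.symm
    have := Nat.eq_zero_of_dvd_of_lt this (by omega)
    omega

variable {q u v : ℕ} {w : ℕ → ℝ} {W : ℝ}

theorem progSum_nonneg (hw0 : ∀ n ∈ Finset.Ioc u v, 0 ≤ w n) (t : ZMod q) :
    0 ≤ progSum q u v w t :=
  Finset.sum_nonneg fun n hn => hw0 n (Finset.mem_filter.1 hn).1

theorem progSum_le_progSum_add [NeZero q] (hw : AntitoneOn w (Set.Ioc u v))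
    (hw0 : ∀ n ∈ Finset.Ioc u v, 0 ≤ w n) (hW : ∀ n ∈ Finset.Ioc u v, w n ≤ W) (hW0 : 0 ≤ W)
    (s t : ZMod q) : progSum q u v w s ≤ progSum q u v w t + W := by
  set d := (s - t).val with hd
  have hdq : d < q := ZMod.val_lt _
  have hdc : ((d : ℕ) : ZMod q) = s - t := by rw [hd, ZMod.natCast_zmod_val]
  set S := (Finset.Ioc u v).filter fun n : ℕ => (n : ZMod q) = s with hS
  have hsplit := Finset.sum_filter_add_sum_filter_not S (fun n : ℕ => u + d < n) w
  have hlong : ∑ n ∈ S.filter (fun n : ℕ => u + d < n), w n ≤ progSum q u v w t := by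
    calc ∑ n ∈ S.filter (fun n : ℕ => u + d < n), w n
        ≤ ∑ n ∈ S.filter (fun n : ℕ => u + d < n), w (n - d) := by
          refine Finset.sum_le_sum fun n hn => ?_
          simp only [hS, Finset.mem_filter, Finset.mem_Ioc] at hn
          exact hw ⟨by omega, by omega⟩ ⟨by omega, by omega⟩ (Nat.sub_le _ _)
      _ = ∑ m ∈ (S.filter (fun n : ℕ => u + d < n)).image (fun n => n - d), w m := by
          rw [Finset.sum_image]
          intro a ha b hb hab
          simp only [hS, Finset.coe_filter, Finset.mem_filter, Set.mem_ofPred_eq] at ha hb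
          simp only at hab
          omega
      _ ≤ progSum q u v w t := by
          refine Finset.sum_le_sum_of_subset_of_nonneg ?_ fun n hn _ =>
            hw0 n (Finset.mem_filter.1 hn).1
          intro m hm
          simp only [hS, Finset.mem_image, Finset.mem_filter, Finset.mem_Ioc] at hm ⊢
          obtain ⟨n, ⟨⟨⟨h1, h2⟩, h3⟩, h4⟩, rfl⟩ := hm
          refine ⟨by omega, ?_⟩
          rw [Nat.cast_sub (by omega), h3, hdc]; ring
  have hshort : ∑ n ∈ S.filter (fun n : ℕ => ¬ u + d < n), w n ≤ W := by
    have hcard : (S.filter (fun n : ℕ => ¬ u + d < n)).card ≤ 1 := by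
      refine card_residue_le_one (u := u) hdq.le _ s fun n hn => ?_
      simp only [hS, Finset.mem_filter, Finset.mem_Ioc] at hn
      exact ⟨hn.1.1.1, by omega, hn.1.2⟩
    calc ∑ n ∈ S.filter (fun n : ℕ => ¬ u + d < n), w n
        ≤ (S.filter (fun n : ℕ => ¬ u + d < n)).card • W :=
          Finset.sum_le_card_nsmul _ _ _ fun n hn =>
            hW n (Finset.mem_filter.1 (Finset.mem_filter.1 hn).1).1
      _ ≤ 1 • W := by gcongr
      _ = W := one_nsmul W
  have : progSum q u v w s = ∑ n ∈ S, w n := rfl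
  linarith

theorem exists_sum_progSum_sub_sq_le [Fact q.Prime] (hw : AntitoneOn w (Set.Ioc u v))
    (hw0 : ∀ n ∈ Finset.Ioc u v, 0 ≤ w n) (hW : ∀ n ∈ Finset.Ioc u v, w n ≤ W) (hW0 : 0 ≤ W) :
    ∃ κ : ℝ, ∑ t : (ZMod q)ˣ, (progSum q u v w t - κ) ^ 2 ≤ W ^ 2 * v := by
  rcases lt_or_ge v q with h | h
  · refine ⟨0, ?_⟩
    have hle : ∀ t : ZMod q, progSum q u v w t ≤ W := by
      intro t
      have hcard : ((Finset.Ioc u v).filter fun n : ℕ => (n : ZMod q) = t).card ≤ 1 := by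
        refine card_residue_le_one (u := 0) h.le _ t fun n hn => ?_
        simp only [Finset.mem_filter, Finset.mem_Ioc] at hn
        exact ⟨by omega, by omega, hn.2⟩
      calc progSum q u v w t
          ≤ ((Finset.Ioc u v).filter fun n : ℕ => (n : ZMod q) = t).card • W :=
            Finset.sum_le_card_nsmul _ _ _ fun n hn => hW n (Finset.mem_filter.1 hn).1
        _ ≤ 1 • W := by gcongr
        _ = W := one_nsmul W
    have hsum : ∑ t : ZMod q, progSum q u v w t ≤ W * v := by
      unfold progSum
      rw [Finset.sum_fiberwise]
      calc ∑ n ∈ Finset.Ioc u v, w n ≤ (Finset.Ioc u v).card • W :=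
            Finset.sum_le_card_nsmul _ _ _ hW
        _ = ((v - u : ℕ) : ℝ) * W := by rw [Nat.card_Ioc, nsmul_eq_mul]
        _ ≤ v * W := by gcongr; exact Nat.sub_le _ _
        _ = W * v := mul_comm _ _
    have hunits : ∑ t : (ZMod q)ˣ, progSum q u v w t ≤ ∑ t : ZMod q, progSum q u v w t := by
      rw [← Finset.sum_image (s := Finset.univ) (g := fun t : (ZMod q)ˣ => (t : ZMod q))
        (f := fun t => progSum q u v w t) (fun a _ b _ h => Units.ext h)]
      exact Finset.sum_le_sum_of_subset_of_nonneg (Finset.subset_univ _)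
        fun t _ _ => progSum_nonneg hw0 t
    calc ∑ t : (ZMod q)ˣ, (progSum q u v w t - 0) ^ 2
        ≤ ∑ t : (ZMod q)ˣ, W * progSum q u v w t := by
          refine Finset.sum_le_sum fun t _ => ?_
          rw [sub_zero, sq]
          exact mul_le_mul_of_nonneg_right (hle t) (progSum_nonneg hw0 _)
      _ = W * ∑ t : (ZMod q)ˣ, progSum q u v w t := by rw [Finset.mul_sum]
      _ ≤ W * (W * v) := by gcongr; exact hunits.trans hsum
      _ = W ^ 2 * v := by ring
  · refine ⟨progSum q u v w 1, ?_⟩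
    calc ∑ t : (ZMod q)ˣ, (progSum q u v w t - progSum q u v w 1) ^ 2
        ≤ ∑ _t : (ZMod q)ˣ, W ^ 2 := by
          refine Finset.sum_le_sum fun t _ => sq_le_sq' ?_ ?_
          · linarith [progSum_le_progSum_add hw hw0 hW hW0 1 (t : ZMod q)]
          · linarith [progSum_le_progSum_add hw hw0 hW hW0 (t : ZMod q) 1]
      _ = ((q - 1 : ℕ) : ℝ) * W ^ 2 := by
          rw [Finset.sum_const, Finset.card_univ, ZMod.card_units, nsmul_eq_mul]
      _ ≤ v * W ^ 2 := by gcongr; omega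
      _ = W ^ 2 * v := mul_comm _ _

end Progressions

section CharacterMoments

variable {q : ℕ} [Fact q.Prime]

theorem sum_norm_sq_sum_char {ι : Type*} (s : Finset ι) (f : ι → ZMod q) (d : ι → ℝ) :
    ∑ χ : DirichletCharacter ℂ q, ‖∑ i ∈ s, (d i : ℂ) * χ (f i)‖ ^ 2 =
      (q.totient : ℝ) * ∑ ℓ : (ZMod q)ˣ, (∑ i ∈ s.filter fun i => f i = ℓ, d i) ^ 2 := by
  set D : (ZMod q)ˣ → ℝ := fun ℓ => ∑ i ∈ s.filter fun i => f i = ℓ, d i with hD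
  have hgroup : ∀ χ : DirichletCharacter ℂ q,
      ∑ i ∈ s, (d i : ℂ) * χ (f i) = ∑ ℓ : (ZMod q)ˣ, (D ℓ : ℂ) * χ ℓ := by
    intro χ
    simp only [hD, Complex.ofReal_sum, Finset.sum_mul, Finset.sum_filter]
    rw [Finset.sum_comm]
    refine Finset.sum_congr rfl fun i _ => ?_
    by_cases hi : IsUnit (f i)
    · obtain ⟨g, hg⟩ := hi
      rw [Finset.sum_eq_single g]
      · rw [if_pos hg.symm, hg]
      · intro b _ hb
        have : f i ≠ b := by
          rw [← hg]; exact fun h => hb (Units.ext h.symm)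
        simp [this]
      · simp
    · rw [χ.map_nonunit hi, mul_zero, eq_comm]
      refine Finset.sum_eq_zero fun b _ => ?_
      have : f i ≠ b := fun h => hi (h ▸ b.isUnit)
      simp [this]
  have hstar : ∀ (χ : DirichletCharacter ℂ q) (a : ZMod q),
      (starRingEnd ℂ) (χ a) = χ a⁻¹ := by
    intro χ a
    rw [← MulChar.inv_apply', ← MulChar.star_apply' χ a]; rfl
  have key : ∑ χ : DirichletCharacter ℂ q,
      ((‖∑ i ∈ s, (d i : ℂ) * χ (f i)‖ ^ 2 : ℝ) : ℂ) =
      (q.totient : ℂ) * ∑ ℓ : (ZMod q)ˣ, (D ℓ : ℂ) ^ 2 := by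
    calc ∑ χ : DirichletCharacter ℂ q, ((‖∑ i ∈ s, (d i : ℂ) * χ (f i)‖ ^ 2 : ℝ) : ℂ)
        = ∑ χ : DirichletCharacter ℂ q, ∑ ℓ : (ZMod q)ˣ, ∑ m : (ZMod q)ˣ,
            (D ℓ : ℂ) * D m * (χ (m : ZMod q)⁻¹ * χ ℓ) := by
          refine Finset.sum_congr rfl fun χ _ => ?_
          rw [hgroup, Complex.ofReal_pow, ← Complex.mul_conj', map_sum, Finset.sum_mul_sum]
          refine Finset.sum_congr rfl fun ℓ _ => Finset.sum_congr rfl fun m _ => ?_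
          rw [map_mul, Complex.conj_ofReal, hstar]
          ring
      _ = ∑ ℓ : (ZMod q)ˣ, ∑ m : (ZMod q)ˣ, (D ℓ : ℂ) * D m *
            ∑ χ : DirichletCharacter ℂ q, (χ (m : ZMod q)⁻¹ * χ ℓ) := by
          rw [Finset.sum_comm]
          refine Finset.sum_congr rfl fun ℓ _ => ?_
          rw [Finset.sum_comm]
          exact Finset.sum_congr rfl fun m _ => by rw [Finset.mul_sum]
      _ = ∑ ℓ : (ZMod q)ˣ, (D ℓ : ℂ) ^ 2 * q.totient := by
          refine Finset.sum_congr rfl fun ℓ _ => ?_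
          rw [Finset.sum_eq_single ℓ]
          · rw [DirichletCharacter.sum_char_inv_mul_char_eq ℂ ℓ.isUnit, if_pos rfl]; ring
          · intro m _ hm
            rw [DirichletCharacter.sum_char_inv_mul_char_eq ℂ m.isUnit,
              if_neg (fun h => hm (Units.ext h)), mul_zero]
          · exact fun h => absurd (Finset.mem_univ ℓ) h
      _ = _ := by rw [← Finset.sum_mul, mul_comm]
  exact_mod_cast key

theorem card_Icc_residue_le (Y : ℕ) (t : ZMod q) :
    ((Finset.Icc 1 Y).filter fun n : ℕ => (n : ZMod q) = t).card ≤ Y / q + 1 := by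
  rw [← Finset.card_range (Y / q + 1)]
  refine Finset.card_le_card_of_injOn (fun n => n / q) ?_ ?_
  · intro n hn
    simp only [Finset.coe_filter, Finset.mem_Icc, Set.mem_ofPred_eq, Finset.coe_range,
      Set.mem_Iio] at hn ⊢
    exact Nat.lt_succ_of_le (Nat.div_le_div_right hn.1.2)
  · intro a ha b hb hab
    simp only [Finset.coe_filter, Set.mem_ofPred_eq] at ha hb
    have h : a % q = b % q := (ZMod.natCast_eq_natCast_iff _ _ _).1 (ha.2.trans hb.2.symm)
    simp only at hab
    rw [← Nat.div_add_mod a q, ← Nat.div_add_mod b q, h, hab]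

theorem card_pow_residue_le {m : ℕ} (hm : 0 < m) (Y : ℕ) (t : ZMod q) :
    ((Finset.Icc 1 Y).filter fun n : ℕ => (n : ZMod q) ^ m = t).card ≤ m * (Y / q + 1) := by
  have hsub : ((Finset.Icc 1 Y).filter fun n : ℕ => (n : ZMod q) ^ m = t) ⊆
      (Polynomial.nthRoots m t).toFinset.biUnion fun r =>
        (Finset.Icc 1 Y).filter fun n : ℕ => (n : ZMod q) = r := by
    intro n hn
    simp only [Finset.mem_filter, Finset.mem_biUnion, Multiset.mem_toFinset,
      Polynomial.mem_nthRoots hm] at hn ⊢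
    exact ⟨n, hn.2, hn.1, rfl⟩
  refine (Finset.card_le_card hsub).trans (Finset.card_biUnion_le.trans ?_)
  refine (Finset.sum_le_card_nsmul _ _ _ fun r _ => card_Icc_residue_le Y r).trans ?_
  rw [smul_eq_mul]
  exact Nat.mul_le_mul_right _
    ((Multiset.toFinset_card_le _).trans (Polynomial.card_nthRoots m t))

theorem sum_norm_sq_sum_char_pow_le {m : ℕ} (hm : 0 < m) (Y : ℕ) {d : ℕ → ℝ} {D : ℝ}
    (hd0 : ∀ n ∈ Finset.Icc 1 Y, 0 ≤ d n) (hd : ∀ n ∈ Finset.Icc 1 Y, d n ≤ D) :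
    ∑ χ : DirichletCharacter ℂ q, ‖∑ n ∈ Finset.Icc 1 Y, (d n : ℂ) * χ ((n : ZMod q) ^ m)‖ ^ 2 ≤
      (q.totient : ℝ) * (D ^ 2 * (m * (Y * (Y / q + 1)))) := by
  rw [sum_norm_sq_sum_char]
  set c : (ZMod q)ˣ → ℕ := fun ℓ =>
    ((Finset.Icc 1 Y).filter fun n : ℕ => (n : ZMod q) ^ m = ℓ).card with hc
  have hsum : ∑ ℓ : (ZMod q)ˣ, c ℓ ≤ Y := by
    calc ∑ ℓ : (ZMod q)ˣ, c ℓ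
        = ((Finset.univ : Finset (ZMod q)ˣ).biUnion fun ℓ =>
            (Finset.Icc 1 Y).filter fun n : ℕ => (n : ZMod q) ^ m = ℓ).card := by
          rw [Finset.card_biUnion]
          intro a _ b _ hab
          rw [Function.onFun, Finset.disjoint_filter]
          exact fun n _ h1 h2 => hab (Units.ext (h1.symm.trans h2))
      _ ≤ (Finset.Icc 1 Y).card := by
          refine Finset.card_le_card fun n hn => ?_
          simp only [Finset.mem_biUnion, Finset.mem_filter] at hn
          obtain ⟨_, _, h, _⟩ := hn
          exact h
      _ = Y := by simp
  have hfib : ∀ ℓ : (ZMod q)ˣ, (c ℓ : ℝ) ≤ m * (Y / q + 1) := by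
    intro ℓ
    have h : (c ℓ : ℝ) ≤ ((m * (Y / q + 1) : ℕ) : ℝ) := by
      exact Nat.cast_le.2 (card_pow_residue_le hm Y (ℓ : ZMod q))
    refine h.trans ?_
    push_cast
    gcongr
    exact Nat.cast_div_le
  gcongr
  calc ∑ ℓ : (ZMod q)ˣ,
        (∑ n ∈ (Finset.Icc 1 Y).filter fun n : ℕ => (n : ZMod q) ^ m = ℓ, d n) ^ 2
      ≤ ∑ ℓ : (ZMod q)ˣ, D ^ 2 * ((m * (Y / q + 1)) * c ℓ) := by
        refine Finset.sum_le_sum fun ℓ _ => ?_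
        have h1 : ∑ n ∈ (Finset.Icc 1 Y).filter fun n : ℕ => (n : ZMod q) ^ m = ℓ, d n
            ≤ c ℓ * D := by
          rw [← nsmul_eq_mul]
          exact Finset.sum_le_card_nsmul _ _ _ fun n hn => hd n (Finset.mem_filter.1 hn).1
        have h0 : 0 ≤ ∑ n ∈ (Finset.Icc 1 Y).filter fun n : ℕ => (n : ZMod q) ^ m = ℓ, d n :=
          Finset.sum_nonneg fun n hn => hd0 n (Finset.mem_filter.1 hn).1
        calc _ ≤ (c ℓ * D) ^ 2 := by gcongr
          _ = D ^ 2 * (c ℓ * c ℓ) := by ring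
          _ ≤ D ^ 2 * ((m * (Y / q + 1)) * c ℓ) := by gcongr; exact hfib ℓ
    _ = D ^ 2 * ((m * (Y / q + 1)) * ((∑ ℓ : (ZMod q)ˣ, c ℓ : ℕ) : ℝ)) := by
        rw [← Finset.mul_sum, ← Finset.mul_sum, Nat.cast_sum]
    _ ≤ D ^ 2 * ((m * (Y / q + 1)) * Y) := by gcongr
    _ = D ^ 2 * (m * (Y * (Y / q + 1))) := by ring

/-- The number of factorizations of `n` into `k` factors not exceeding `A`. -/
noncomputable def boundedFactorizations (k A n : ℕ) : ℕ :=
  ((Fintype.piFinset fun _ : Fin k => Finset.Icc 1 A).filter fun g => ∏ i, g i = n).card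

theorem boundedFactorizations_le (k A : ℕ) {n : ℕ} (hn : n ≠ 0) :
    boundedFactorizations k A n ≤ n.divisors.card ^ k := by
  have : n.divisors.card ^ k = (Fintype.piFinset fun _ : Fin k => n.divisors).card := by
    rw [Fintype.card_piFinset]; simp
  rw [this]
  refine Finset.card_le_card fun g hg => ?_
  simp only [Finset.mem_filter] at hg
  rw [Fintype.mem_piFinset]
  intro i
  rw [Nat.mem_divisors]
  exact ⟨hg.2 ▸ Finset.dvd_prod_of_mem g (Finset.mem_univ i), hn⟩

theorem sum_char_pow_eq (χ : DirichletCharacter ℂ q) (k m A : ℕ) :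
    (∑ a ∈ Finset.Icc 1 A, χ ((a : ZMod q) ^ m)) ^ k =
      ∑ n ∈ Finset.Icc 1 (A ^ k),
        ((boundedFactorizations k A n : ℝ) : ℂ) * χ ((n : ZMod q) ^ m) := by
  have h := Finset.prod_univ_sum (fun _ : Fin k => Finset.Icc 1 A)
    (fun _ a => χ ((a : ZMod q) ^ m))
  rw [Finset.prod_const, Finset.card_univ, Fintype.card_fin] at h
  rw [h, ← Finset.sum_fiberwise_of_maps_to (t := Finset.Icc 1 (A ^ k)) (g := fun g => ∏ i, g i)]
  · refine Finset.sum_congr rfl fun n _ => ?_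
    rw [boundedFactorizations, Complex.ofReal_natCast, ← nsmul_eq_mul, ← Finset.sum_const]
    refine Finset.sum_congr rfl fun g hg => ?_
    rw [← (Finset.mem_filter.1 hg).2, ← map_prod, Finset.prod_pow, Nat.cast_prod]
  · intro g hg
    rw [Fintype.mem_piFinset] at hg
    simp only [Finset.mem_Icc] at hg ⊢
    refine ⟨Finset.one_le_prod' fun i _ => (hg i).1, ?_⟩
    calc ∏ i, g i ≤ ∏ _i : Fin k, A := Finset.prod_le_prod' fun i _ => (hg i).2
      _ = A ^ k := by simp

theorem sum_norm_sum_char_pow_le {k m : ℕ} (hm : 0 < m) (A : ℕ) {D : ℝ}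
    (hdiv : ∀ n ∈ Finset.Icc 1 (A ^ k), (n.divisors.card : ℝ) ^ k ≤ D) :
    ∑ χ : DirichletCharacter ℂ q, ‖∑ a ∈ Finset.Icc 1 A, χ ((a : ZMod q) ^ m)‖ ^ (2 * k) ≤
      (q.totient : ℝ) * (D ^ 2 * (m * ((A : ℝ) ^ k * ((A : ℝ) ^ k / q + 1)))) := by
  have h := sum_norm_sq_sum_char_pow_le (q := q) hm (A ^ k)
    (d := fun n => (boundedFactorizations k A n : ℝ)) (D := D) (fun n _ => Nat.cast_nonneg _)
    (fun n hn => le_trans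
      (mod_cast boundedFactorizations_le k A
            (Nat.one_le_iff_ne_zero.1 (Finset.mem_Icc.1 hn).1))
      (hdiv n hn))
  push_cast at h
  refine le_trans (le_of_eq (Finset.sum_congr rfl fun χ _ => ?_)) h
  rw [mul_comm, pow_mul, ← norm_pow, sum_char_pow_eq]
  push_cast
  rfl

end CharacterMoments

section DivisorBound

theorem exists_card_divisors_le_rpow {δ : ℝ} (hδ : 0 < δ) :
    ∃ C : ℝ, 1 ≤ C ∧ ∀ n : ℕ, n ≠ 0 → (n.divisors.card : ℝ) ≤ C * (n : ℝ) ^ δ := by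
  have hlog : 0 < Real.log 2 := Real.log_pos one_lt_two
  set K : ℝ := 1 + 1 / (δ * Real.log 2) with hK
  have hK1 : 1 ≤ K := by rw [hK]; linarith [show 0 < 1 / (δ * Real.log 2) by positivity]
  set P : ℕ := ⌈(2 : ℝ) ^ (1 / δ)⌉₊ with hP
  have hsmall : ∀ p e : ℕ, 2 ≤ p → ((e : ℝ) + 1) ≤ K * (((p : ℝ) ^ e) ^ δ) := by
    intro p e hp
    have h2 : (2 : ℝ) ≤ p := by exact_mod_cast hp
    have h1 : 1 + (e : ℝ) * δ * Real.log 2 ≤ ((p : ℝ) ^ e) ^ δ := by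
      calc 1 + (e : ℝ) * δ * Real.log 2 = Real.log 2 * (e * δ) + 1 := by ring
        _ ≤ Real.exp (Real.log 2 * (e * δ)) := Real.add_one_le_exp _
        _ = (2 : ℝ) ^ ((e : ℝ) * δ) := by rw [Real.rpow_def_of_pos two_pos]
        _ ≤ (p : ℝ) ^ ((e : ℝ) * δ) := by gcongr
        _ = ((p : ℝ) ^ e) ^ δ := by rw [Real.rpow_mul (by positivity), Real.rpow_natCast]
    calc (e : ℝ) + 1 ≤ K * (1 + (e : ℝ) * δ * Real.log 2) := by
          have : 1 / (δ * Real.log 2) * (e * δ * Real.log 2) = e := by field_simp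
          rw [hK]
          nlinarith [show 0 < 1 / (δ * Real.log 2) by positivity,
            show (0 : ℝ) ≤ e * δ * Real.log 2 by positivity]
      _ ≤ _ := by gcongr
  have hlarge : ∀ p e : ℕ, P ≤ p → ((e : ℝ) + 1) ≤ (((p : ℝ) ^ e) ^ δ) := by
    intro p e hp
    have h2 : (2 : ℝ) ^ (1 / δ) ≤ p := (Nat.le_ceil _).trans (by exact_mod_cast hp)
    calc (e : ℝ) + 1 ≤ 2 ^ e := by
          have : e + 1 ≤ 2 ^ e := Nat.lt_two_pow_self
          exact_mod_cast this
      _ = ((2 : ℝ) ^ (1 / δ)) ^ ((e : ℝ) * δ) := by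
          rw [← Real.rpow_mul two_pos.le, ← Real.rpow_natCast]; congr 1; field_simp
      _ ≤ (p : ℝ) ^ ((e : ℝ) * δ) := by gcongr
      _ = ((p : ℝ) ^ e) ^ δ := by rw [Real.rpow_mul (by positivity), Real.rpow_natCast]
  refine ⟨K ^ P, one_le_pow₀ hK1, fun n hn => ?_⟩
  rw [Nat.card_divisors hn]
  push_cast
  have hn' : ((n : ℝ)) ^ δ = ∏ p ∈ n.primeFactors, (((p : ℝ) ^ n.factorization p) ^ δ) := by
    conv_lhs => rw [← Nat.prod_factorization_pow_eq_self hn]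
    rw [Finsupp.prod, Nat.support_factorization]
    push_cast
    rw [Real.finsetProd_rpow _ _ fun p _ => by positivity]
  rw [hn']
  calc ∏ p ∈ n.primeFactors, ((n.factorization p : ℝ) + 1)
      ≤ ∏ p ∈ n.primeFactors, ((if p < P then K else 1) * (((p : ℝ) ^ n.factorization p) ^ δ)) := by
        refine Finset.prod_le_prod (fun p _ => by positivity) fun p hp => ?_
        split_ifs with h
        · exact hsmall p _ (Nat.prime_of_mem_primeFactors hp).two_le
        · rw [one_mul]; exact hlarge p _ (not_lt.1 h)
    _ = (∏ p ∈ n.primeFactors, if p < P then K else 1) *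
          ∏ p ∈ n.primeFactors, (((p : ℝ) ^ n.factorization p) ^ δ) := Finset.prod_mul_distrib
    _ ≤ K ^ P * ∏ p ∈ n.primeFactors, (((p : ℝ) ^ n.factorization p) ^ δ) := by
        gcongr
        rw [Finset.prod_ite, Finset.prod_const, Finset.prod_const_one, mul_one]
        refine pow_le_pow_right₀ hK1 ?_
        refine (Finset.card_le_card (t := Finset.range P) fun p hp => ?_).trans
          (Finset.card_range P).le
        exact Finset.mem_range.2 (Finset.mem_filter.1 hp).2

end DivisorBound

section HolderMoments

theorem sum_sq_mul_sq_le_of_moments {ι : Type*} (s : Finset ι) {u v : ι → ℝ}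
    (hu : ∀ i, 0 ≤ u i) (hv : ∀ i, 0 ≤ v i) {k : ℕ} (hk : 2 ≤ k) {M₂ M₄ M : ℝ}
    (hM₂ : 0 < M₂) (hM₄ : 0 < M₄) (hM : 0 < M) (h₂ : ∑ i ∈ s, u i ^ 2 ≤ M₂)
    (h₄ : ∑ i ∈ s, u i ^ 4 ≤ M₄) (h : ∑ i ∈ s, v i ^ (2 * k) ≤ M) :
    ∑ i ∈ s, u i ^ 2 * v i ^ 2 ≤
      M₂ ^ (((k : ℝ) - 2) / k) * M₄ ^ ((1 : ℝ) / k) * M ^ ((1 : ℝ) / k) := by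
  have hk2 : (2 : ℝ) ≤ k := by exact_mod_cast hk
  have hk0 : (0 : ℝ) < k := by linarith
  set w₁ : ℝ := ((k : ℝ) - 2) / k with hw₁
  set w₂ : ℝ := (1 : ℝ) / k with hw₂
  have h1 : 0 ≤ w₁ := div_nonneg (by linarith) hk0.le
  have h2 : 0 ≤ w₂ := by positivity
  have hw : w₁ + w₂ + w₂ = 1 := by rw [hw₁, hw₂]; field_simp; ring
  have hpt : ∀ i, u i ^ 2 * v i ^ 2 ≤ (M₂ ^ w₁ * M₄ ^ w₂ * M ^ w₂) *
      (w₁ * (u i ^ 2 / M₂) + w₂ * (u i ^ 4 / M₄) + w₂ * (v i ^ (2 * k) / M)) := by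
    intro i
    have hui := hu i
    have hvi := hv i
    have e1 : (u i ^ 2) ^ w₁ * (u i ^ 4) ^ w₂ = u i ^ 2 := by
      rw [← Real.rpow_natCast, ← Real.rpow_natCast, ← Real.rpow_mul hui, ← Real.rpow_mul hui,
        ← Real.rpow_add_of_nonneg hui (by positivity) (by positivity)]
      congr 1
      rw [hw₁, hw₂]; push_cast; field_simp; ring
    have e2 : (v i ^ (2 * k)) ^ w₂ = v i ^ 2 := by
      rw [← Real.rpow_natCast, ← Real.rpow_mul hvi, ← Real.rpow_natCast]
      congr 1
      rw [hw₂]; push_cast; field_simp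
    have e3 : u i ^ 2 * v i ^ 2 = (M₂ ^ w₁ * M₄ ^ w₂ * M ^ w₂) *
        ((u i ^ 2 / M₂) ^ w₁ * (u i ^ 4 / M₄) ^ w₂ * (v i ^ (2 * k) / M) ^ w₂) := by
      rw [Real.div_rpow (by positivity) hM₂.le, Real.div_rpow (by positivity) hM₄.le,
        Real.div_rpow (by positivity) hM.le, e2]
      have a1 := Real.rpow_pos_of_pos hM₂ w₁
      have a2 := Real.rpow_pos_of_pos hM₄ w₂
      have a3 := Real.rpow_pos_of_pos hM w₂
      field_simp
      linear_combination (-(v i) ^ 2) * e1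
    rw [e3]
    refine mul_le_mul_of_nonneg_left ?_ (by positivity)
    exact Real.geom_mean_le_arith_mean3_weighted h1 h2 h2 (by positivity) (by positivity)
      (by positivity) hw
  calc ∑ i ∈ s, u i ^ 2 * v i ^ 2
      ≤ ∑ i ∈ s, (M₂ ^ w₁ * M₄ ^ w₂ * M ^ w₂) *
        (w₁ * (u i ^ 2 / M₂) + w₂ * (u i ^ 4 / M₄) + w₂ * (v i ^ (2 * k) / M)) :=
        Finset.sum_le_sum fun i _ => hpt i
    _ = (M₂ ^ w₁ * M₄ ^ w₂ * M ^ w₂) * (w₁ * ((∑ i ∈ s, u i ^ 2) / M₂) +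
          w₂ * ((∑ i ∈ s, u i ^ 4) / M₄) + w₂ * ((∑ i ∈ s, v i ^ (2 * k)) / M)) := by
        rw [← Finset.mul_sum, Finset.sum_add_distrib, Finset.sum_add_distrib, ← Finset.mul_sum,
          ← Finset.mul_sum, ← Finset.mul_sum, ← Finset.sum_div, ← Finset.sum_div,
          ← Finset.sum_div]
    _ ≤ (M₂ ^ w₁ * M₄ ^ w₂ * M ^ w₂) * (w₁ * 1 + w₂ * 1 + w₂ * 1) := by
        gcongr
        · exact (div_le_one hM₂).2 h₂
        · exact (div_le_one hM₄).2 h₄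
        · exact (div_le_one hM).2 h
    _ = _ := by rw [mul_one, mul_one, hw, mul_one]

theorem exists_sum_card_sq_le {k : ℕ} (hk : 2 ≤ k) {δ : ℝ} (hδ : 0 < δ) :
    ∃ C : ℝ, 0 < C ∧ ∀ (q : ℕ) [Fact q.Prime] (A B : ℕ) (Z : ℝ), 1 ≤ A → 1 ≤ B →
      (A : ℝ) ≤ Z → (B : ℝ) ≤ Z →
      ∑ ℓ : (ZMod q)ˣ, ((((Finset.Icc 1 A) ×ˢ (Finset.Icc 1 B)).filter fun p : ℕ × ℕ =>
        (p.1 : ZMod q) ^ 2 * (p.2 : ZMod q) ^ 3 = ℓ).card : ℝ) ^ 2 ≤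
      C * Z ^ δ * ((A : ℝ) * B * ((A : ℝ) / q + 1) * ((A : ℝ) ^ 2 / q + 1) ^ ((1 : ℝ) / k) *
        ((B : ℝ) ^ k / q + 1) ^ ((1 : ℝ) / k)) := by
  have hk2 : (2 : ℝ) ≤ k := by exact_mod_cast hk
  have hk0 : (0 : ℝ) < k := by linarith
  obtain ⟨C, hC1, hC⟩ := exists_card_divisors_le_rpow (δ := δ / (2 * k ^ 2)) (by positivity)
  refine ⟨3 * (C ^ k) ^ 2, by positivity, ?_⟩
  intro q _ A B Z hA hB hAZ hBZ
  have hA' : (1 : ℝ) ≤ A := by exact_mod_cast hA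
  have hB' : (1 : ℝ) ≤ B := by exact_mod_cast hB
  have hZ : 1 ≤ Z := hA'.trans hAZ
  have hq : (0 : ℝ) < q := by exact_mod_cast (Fact.out : q.Prime).pos
  have hφ : (0 : ℝ) < q.totient := by exact_mod_cast Nat.totient_pos.2 (Fact.out : q.Prime).pos
  set D : ℝ := (C * (Z ^ k) ^ (δ / (2 * k ^ 2))) ^ k with hD
  have hbase : 1 ≤ C * (Z ^ k) ^ (δ / (2 * k ^ 2)) :=
    one_le_mul_of_one_le_of_one_le hC1
      (Real.one_le_rpow (one_le_pow₀ hZ) (by positivity))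
  have hD0 : 0 < D := by positivity
  have hdiv : ∀ (Y : ℕ) (j : ℕ), (Y : ℝ) ≤ Z → j ≤ k → ∀ n ∈ Finset.Icc 1 (Y ^ j),
      (n.divisors.card : ℝ) ^ j ≤ D := by
    intro Y j hY hj n hn
    rw [Finset.mem_Icc] at hn
    have hnZ : (n : ℝ) ≤ Z ^ k := by
      calc (n : ℝ) ≤ ((Y ^ j : ℕ) : ℝ) := by exact_mod_cast hn.2
        _ = (Y : ℝ) ^ j := by push_cast; rfl
        _ ≤ Z ^ j := by gcongr
        _ ≤ Z ^ k := pow_le_pow_right₀ hZ hj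
    calc (n.divisors.card : ℝ) ^ j ≤ (C * (n : ℝ) ^ (δ / (2 * k ^ 2))) ^ j := by
          gcongr; exact hC n (by omega)
      _ ≤ (C * (Z ^ k) ^ (δ / (2 * k ^ 2))) ^ j := by gcongr
      _ ≤ D := pow_le_pow_right₀ hbase hj
  have hD2 : D ^ 2 = (C ^ k) ^ 2 * Z ^ δ := by
    rw [hD, mul_pow, mul_pow]
    congr 1
    rw [← Real.rpow_natCast Z k, ← Real.rpow_mul (by positivity), ← Real.rpow_natCast,
      ← Real.rpow_natCast, ← Real.rpow_mul (by positivity), ← Real.rpow_mul (by positivity)]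
    congr 1
    push_cast
    field_simp
  have m₂ := sum_norm_sum_char_pow_le (q := q) (k := 1) (m := 2) two_pos A
    (hdiv A 1 hAZ (by omega))
  have m₄ := sum_norm_sum_char_pow_le (q := q) (k := 2) (m := 2) two_pos A (hdiv A 2 hAZ hk)
  have m := sum_norm_sum_char_pow_le (q := q) (k := k) (m := 3) three_pos B
    (hdiv B k hBZ le_rfl)
  have hH := sum_sq_mul_sq_le_of_moments (Finset.univ : Finset (DirichletCharacter ℂ q))
    (u := fun χ => ‖∑ a ∈ Finset.Icc 1 A, χ ((a : ZMod q) ^ 2)‖)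
    (v := fun χ => ‖∑ b ∈ Finset.Icc 1 B, χ ((b : ZMod q) ^ 3)‖)
    (fun _ => norm_nonneg _) (fun _ => norm_nonneg _) hk
    (by positivity) (by positivity) (by positivity) m₂ m₄ m
  have hP := sum_norm_sq_sum_char (q := q) ((Finset.Icc 1 A) ×ˢ (Finset.Icc 1 B))
    (fun p : ℕ × ℕ => (p.1 : ZMod q) ^ 2 * (p.2 : ZMod q) ^ 3) (fun _ => 1)
  simp only [Finset.sum_const, nsmul_eq_mul, mul_one] at hP
  have hfac : ∀ χ : DirichletCharacter ℂ q,
      ‖∑ p ∈ (Finset.Icc 1 A) ×ˢ (Finset.Icc 1 B),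
        ((1 : ℝ) : ℂ) * χ ((p.1 : ZMod q) ^ 2 * (p.2 : ZMod q) ^ 3)‖ ^ 2 =
      ‖∑ a ∈ Finset.Icc 1 A, χ ((a : ZMod q) ^ 2)‖ ^ 2 *
        ‖∑ b ∈ Finset.Icc 1 B, χ ((b : ZMod q) ^ 3)‖ ^ 2 := by
    intro χ
    rw [← mul_pow, ← norm_mul, Finset.sum_mul_sum, Finset.sum_product]
    simp only [Complex.ofReal_one, one_mul, map_mul]
  rw [Finset.sum_congr rfl fun χ _ => hfac χ] at hP
  rw [hP] at hH
  refine le_of_mul_le_mul_left (hH.trans ?_) hφ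
  set w₁ : ℝ := ((k : ℝ) - 2) / k with hw₁
  set w₂ : ℝ := (1 : ℝ) / k with hw₂
  have h1 : 0 ≤ w₁ := div_nonneg (by linarith) hk0.le
  have h2 : 0 ≤ w₂ := by positivity
  have hw : w₁ + w₂ + w₂ = 1 := by rw [hw₁, hw₂]; field_simp; ring
  have hwt : ∀ T : ℝ, 0 < T → T ^ w₁ * T ^ w₂ * T ^ w₂ = T := by
    intro T hT
    rw [← Real.rpow_add hT, ← Real.rpow_add hT, hw, Real.rpow_one]
  set a := (A : ℝ) with ha
  set b := (B : ℝ) with hb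
  have hsplit : ∀ (T E Y w : ℝ), 0 < T → 0 < E → 0 < Y →
      (q.totient * (D ^ 2 * (T * (Y * E)))) ^ w =
        (q.totient : ℝ) ^ w * (D ^ 2) ^ w * T ^ w * (Y ^ w * E ^ w) := by
    intro T E Y w hT hE hY
    rw [Real.mul_rpow (by positivity) (by positivity),
      Real.mul_rpow (by positivity) (by positivity),
      Real.mul_rpow (by positivity) (by positivity), Real.mul_rpow hY.le hE.le]
    ring
  have hab : a ^ w₁ * (a ^ 2) ^ w₂ = a := by
    rw [← Real.rpow_natCast, ← Real.rpow_mul (by positivity), ← Real.rpow_add (by positivity)]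
    have : w₁ + ((2 : ℕ) : ℝ) * w₂ = 1 := by push_cast; linarith
    rw [this, Real.rpow_one]
  have hbb : (b ^ k) ^ w₂ = b := by
    rw [← Real.rpow_natCast, ← Real.rpow_mul (by positivity), hw₂, mul_one_div_cancel hk0.ne',
      Real.rpow_one]
  calc (q.totient * (D ^ 2 * ((2 : ℕ) * (a ^ 1 * (a ^ 1 / q + 1))))) ^ w₁ *
        (q.totient * (D ^ 2 * ((2 : ℕ) * (a ^ 2 * (a ^ 2 / q + 1))))) ^ w₂ *
        (q.totient * (D ^ 2 * ((3 : ℕ) * (b ^ k * (b ^ k / q + 1))))) ^ w₂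
      ≤ (q.totient * (D ^ 2 * (3 * (a * (a / q + 1))))) ^ w₁ *
        (q.totient * (D ^ 2 * (3 * (a ^ 2 * (a ^ 2 / q + 1))))) ^ w₂ *
        (q.totient * (D ^ 2 * (3 * (b ^ k * (b ^ k / q + 1))))) ^ w₂ := by
        rw [pow_one]
        gcongr <;> norm_num
    _ = ((q.totient : ℝ) ^ w₁ * (q.totient : ℝ) ^ w₂ * (q.totient : ℝ) ^ w₂) *
        ((D ^ 2) ^ w₁ * (D ^ 2) ^ w₂ * (D ^ 2) ^ w₂) * (3 ^ w₁ * 3 ^ w₂ * 3 ^ w₂) *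
        (a ^ w₁ * (a ^ 2) ^ w₂) * (b ^ k) ^ w₂ *
        ((a / q + 1) ^ w₁ * (a ^ 2 / q + 1) ^ w₂ * (b ^ k / q + 1) ^ w₂) := by
        rw [hsplit _ _ _ _ (by positivity) (by positivity) (by positivity),
          hsplit _ _ _ _ (by positivity) (by positivity) (by positivity),
          hsplit _ _ _ _ (by positivity) (by positivity) (by positivity)]
        ring
    _ = q.totient * D ^ 2 * 3 * a * b *
        ((a / q + 1) ^ w₁ * (a ^ 2 / q + 1) ^ w₂ * (b ^ k / q + 1) ^ w₂) := by
        rw [hwt _ hφ, hwt _ (by positivity), hwt _ three_pos, hab, hbb]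
    _ ≤ q.totient * D ^ 2 * 3 * a * b *
        ((a / q + 1) ^ (1 : ℝ) * (a ^ 2 / q + 1) ^ w₂ * (b ^ k / q + 1) ^ w₂) := by
        gcongr
        · linarith [show 0 ≤ a / q by positivity]
        · linarith
    _ = _ := by rw [hD2, Real.rpow_one]; ring

end HolderMoments

section SquareFibres

theorem norm_twistDev_sq_le_of_square_fibres {G : Type*} [CommGroup G] [Fintype G] [DecidableEq G]
    {α : G} (hα : α ≠ 1)
    (hcard : ∀ g : G, (Finset.univ.filter fun t : G => t ^ 2 = g ∨ t ^ 2 = α * g).card = 2)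
    (h : G) (E : G → ℝ) (κ : ℝ) :
    ‖twistDev α fun ℓ => ∑ t ∈ Finset.univ.filter fun t : G => t ^ 2 = ℓ * h, E t‖ ^ 2 ≤
      ∑ t, (E t - κ) ^ 2 := by
  refine (norm_twistDev_sq_le_of_average α _ κ).trans ?_
  have hpt : ∀ ℓ : G, ((∑ t ∈ Finset.univ.filter fun t : G => t ^ 2 = ℓ * h, E t) +
      ∑ t ∈ Finset.univ.filter fun t : G => t ^ 2 = α * ℓ * h, E t) / 2 - κ =
      (∑ t ∈ Finset.univ.filter fun t : G => t ^ 2 = ℓ * h ∨ t ^ 2 = α * (ℓ * h),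
        (E t - κ)) / 2 := by
    intro ℓ
    rw [Finset.sum_sub_distrib, Finset.sum_const, hcard, Finset.filter_or, Finset.sum_union]
    · simp only [mul_assoc, nsmul_eq_mul]; push_cast; ring
    · rw [Finset.disjoint_filter]
      intro t _ h1 h2
      exact hα (mul_eq_right.1 (h2.symm.trans h1))
  calc ∑ ℓ : G, (((∑ t ∈ Finset.univ.filter fun t : G => t ^ 2 = ℓ * h, E t) +
      ∑ t ∈ Finset.univ.filter fun t : G => t ^ 2 = α * ℓ * h, E t) / 2 - κ) ^ 2
      ≤ ∑ ℓ : G, (∑ t ∈ Finset.univ.filter fun t : G => t ^ 2 = ℓ * h ∨ t ^ 2 = α * (ℓ * h),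
        (E t - κ) ^ 2) / 2 := by
        refine Finset.sum_le_sum fun ℓ _ => ?_
        rw [hpt]
        have := sq_sum_le_card_mul_sum_sq
          (s := Finset.univ.filter fun t : G => t ^ 2 = ℓ * h ∨ t ^ 2 = α * (ℓ * h))
          (f := fun t => E t - κ)
        rw [hcard] at this
        push_cast at this
        linarith
    _ = ∑ t : G, ((Finset.univ.filter fun ℓ : G => t ^ 2 = ℓ * h ∨ t ^ 2 = α * (ℓ * h)).card : ℝ)
          * (E t - κ) ^ 2 / 2 := by
        simp only [← Finset.sum_div, Finset.sum_filter]
        rw [Finset.sum_comm]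
        congr 1
        refine Finset.sum_congr rfl fun t _ => ?_
        rw [← Finset.sum_filter, Finset.sum_const, nsmul_eq_mul]
    _ ≤ ∑ t : G, (2 : ℝ) * (E t - κ) ^ 2 / 2 := by
        refine Finset.sum_le_sum fun t _ => ?_
        have : (Finset.univ.filter fun ℓ : G => t ^ 2 = ℓ * h ∨ t ^ 2 = α * (ℓ * h)) ⊆
            {t ^ 2 * h⁻¹, α⁻¹ * (t ^ 2 * h⁻¹)} := by
          intro ℓ hℓ
          simp only [Finset.mem_filter, Finset.mem_univ, true_and, Finset.mem_insert,
            Finset.mem_singleton] at hℓ ⊢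
          rcases hℓ with h1 | h1
          · left; rw [h1]; group
          · right; rw [h1]; group
        have : (Finset.univ.filter fun ℓ : G => t ^ 2 = ℓ * h ∨ t ^ 2 = α * (ℓ * h)).card ≤ 2 :=
          (Finset.card_le_card this).trans Finset.card_le_two
        gcongr
        exact_mod_cast this
    _ = ∑ t, (E t - κ) ^ 2 := Finset.sum_congr rfl fun t _ => by ring

variable {q : ℕ} [Fact q.Prime]

theorem card_sq_eq_or_sq_eq {g g' : (ZMod q)ˣ} (hq : q ≠ 2) (hg : IsSquare (g : ZMod q))
    (hg' : ¬ IsSquare (g' : ZMod q)) :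
    (Finset.univ.filter fun t : (ZMod q)ˣ => t ^ 2 = g ∨ t ^ 2 = g').card = 2 := by
  obtain ⟨r, hr⟩ := hg
  have hr0 : IsUnit r := isUnit_of_mul_isUnit_left (hr ▸ g.isUnit)
  obtain ⟨s, rfl⟩ := hr0
  have hgs : g = s ^ 2 := Units.ext (by rw [hr]; push_cast; ring)
  have hset : (Finset.univ.filter fun t : (ZMod q)ˣ => t ^ 2 = g ∨ t ^ 2 = g') = {s, -s} := by
    ext t
    simp only [Finset.mem_filter, Finset.mem_univ, true_and, Finset.mem_insert,
      Finset.mem_singleton]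
    constructor
    · rintro (h | h)
      · rw [hgs, Units.ext_iff] at h
        push_cast at h
        rcases sq_eq_sq_iff_eq_or_eq_neg.1 h with h | h
        · exact Or.inl (Units.ext h)
        · exact Or.inr (Units.ext (by rw [h]; rfl))
      · exact absurd ⟨(t : ZMod q), by rw [← h]; push_cast; ring⟩ hg'
    · rintro (rfl | rfl)
      · exact Or.inl hgs.symm
      · exact Or.inl (by rw [hgs, neg_sq])
  rw [hset, Finset.card_pair]
  intro h
  have h2 : (2 : ZMod q) * s = 0 := by
    have : (s : ZMod q) = -s := by
      conv_lhs => rw [h]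
      rfl
    linear_combination this
  have h2' : ((2 : ℕ) : ZMod q) = 0 := by
    rcases mul_eq_zero.1 h2 with h | h
    · exact_mod_cast h
    · exact absurd h s.ne_zero
  rw [ZMod.natCast_eq_zero_iff] at h2'
  exact hq ((Nat.prime_dvd_prime_iff_eq (Fact.out : q.Prime) Nat.prime_two).1 h2')

theorem ne_two_of_not_isSquare {a : ZMod q} (ha : ¬ IsSquare a) : q ≠ 2 := by
  rintro rfl
  exact ha (FiniteField.isSquare_of_char_two (ZMod.ringChar_zmod_n 2) a)

theorem card_sq_eq_or_sq_eq_mul {α : (ZMod q)ˣ} (hα : ¬ IsSquare (α : ZMod q)) (g : (ZMod q)ˣ) :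
    (Finset.univ.filter fun t : (ZMod q)ˣ => t ^ 2 = g ∨ t ^ 2 = α * g).card = 2 := by
  have hq := ne_two_of_not_isSquare hα
  have hchar : ringChar (ZMod q) ≠ 2 := by rwa [ZMod.ringChar_zmod_n]
  have hmul : quadraticChar (ZMod q) ((α * g : (ZMod q)ˣ) : ZMod q) =
      - quadraticChar (ZMod q) (g : ZMod q) := by
    rw [Units.val_mul, map_mul, (quadraticChar_neg_one_iff_not_isSquare).2 hα, neg_one_mul]
  by_cases hg : IsSquare (g : ZMod q)
  · refine card_sq_eq_or_sq_eq hq hg fun h => ?_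
    rw [← quadraticChar_one_iff_isSquare (Units.ne_zero _)] at h hg
    rw [h, hg] at hmul
    norm_num at hmul
  · have : IsSquare ((α * g : (ZMod q)ˣ) : ZMod q) := by
      rw [← quadraticChar_one_iff_isSquare (Units.ne_zero _), hmul,
        quadraticChar_neg_one_iff_not_isSquare.2 hg, neg_neg]
    simpa only [or_comm] using card_sq_eq_or_sq_eq hq this hg

end SquareFibres

section Pieces

/-- The number of `a` with `x < a² m ≤ 2x` and `a² m` in a given residue class. -/
noncomputable def squareCount (x : ℝ) (q m : ℕ) (ℓ : ZMod q) : ℝ :=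
  ∑ a ∈ Finset.Icc 1 ⌊2 * x⌋₊,
    if x < ((a ^ 2 * m : ℕ) : ℝ) ∧ ((a ^ 2 * m : ℕ) : ℝ) ≤ 2 * x ∧
      ((a ^ 2 * m : ℕ) : ZMod q) = ℓ then 1 else 0

/-- The sum of `w n` over `x < n m ≤ 2x` with `n m` in a given residue class. -/
noncomputable def dilatedSum (x : ℝ) (q m : ℕ) (w : ℕ → ℝ) (ℓ : ZMod q) : ℝ :=
  ∑ n ∈ Finset.Icc 1 ⌊2 * x⌋₊,
    if x < ((n * m : ℕ) : ℝ) ∧ ((n * m : ℕ) : ℝ) ≤ 2 * x ∧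
      ((n * m : ℕ) : ZMod q) = ℓ then w n else 0

theorem squareCount_nonneg (x : ℝ) (q m : ℕ) (ℓ : ZMod q) : 0 ≤ squareCount x q m ℓ :=
  Finset.sum_nonneg fun _ _ => by split_ifs <;> norm_num

theorem filter_sq_mul_eq_Ioc {x : ℝ} (hx : 0 ≤ x) {m : ℕ} (hm : 0 < m) :
    ((Finset.Icc 1 ⌊2 * x⌋₊).filter fun a : ℕ =>
      x < ((a ^ 2 * m : ℕ) : ℝ) ∧ ((a ^ 2 * m : ℕ) : ℝ) ≤ 2 * x) =
      Finset.Ioc ⌊√(x / m)⌋₊ ⌊√(2 * x / m)⌋₊ := by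
  have hm' : (0 : ℝ) < m := by exact_mod_cast hm
  ext a
  rw [Finset.mem_filter, Finset.mem_Ioc, Nat.floor_lt (Real.sqrt_nonneg _),
    Nat.le_floor_iff (Real.sqrt_nonneg _), Real.sqrt_lt (by positivity) (by positivity),
    Real.le_sqrt (by positivity) (by positivity), div_lt_iff₀ hm', le_div_iff₀ hm']
  push_cast
  refine ⟨fun h => h.2, fun h => ⟨?_, h⟩⟩
  rw [Finset.mem_Icc]
  have ha : 1 ≤ a := by
    rcases Nat.eq_zero_or_pos a with rfl | h0
    · have := h.1
      norm_num at this
      linarith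
    · exact h0
  refine ⟨ha, Nat.le_floor (le_trans ?_ h.2)⟩
  have : a ≤ a ^ 2 * m := by nlinarith [Nat.mul_le_mul ha hm]
  exact_mod_cast this

theorem filter_mul_eq_Ioc {x : ℝ} (hx : 0 ≤ x) {m : ℕ} (hm : 0 < m) :
    ((Finset.Icc 1 ⌊2 * x⌋₊).filter fun n : ℕ =>
      x < ((n * m : ℕ) : ℝ) ∧ ((n * m : ℕ) : ℝ) ≤ 2 * x) =
      Finset.Ioc ⌊x / m⌋₊ ⌊2 * x / m⌋₊ := by
  have hm' : (0 : ℝ) < m := by exact_mod_cast hm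
  ext a
  rw [Finset.mem_filter, Finset.mem_Ioc, Nat.floor_lt (by positivity),
    Nat.le_floor_iff (by positivity), div_lt_iff₀ hm', le_div_iff₀ hm']
  push_cast
  refine ⟨fun h => h.2, fun h => ⟨?_, h⟩⟩
  rw [Finset.mem_Icc]
  have ha : 1 ≤ a := by
    rcases Nat.eq_zero_or_pos a with rfl | h0
    · have := h.1
      norm_num at this
      linarith
    · exact h0
  refine ⟨ha, Nat.le_floor (le_trans ?_ h.2)⟩
  have : a ≤ a * m := Nat.le_mul_of_pos_right a hm
  exact_mod_cast this

theorem twistDev_eq_zero {G : Type*} [CommGroup G] [Fintype G] (α : G) {F : G → ℝ}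
    (hF : ∀ t, F t = 0) : twistDev α F = 0 := by
  have : F = 0 := funext hF
  rw [this, map_zero]

variable {q : ℕ} [Fact q.Prime]

theorem norm_twistDev_squareCount_sq_le {x : ℝ} (hx : 0 ≤ x) {m : ℕ} (hm : 0 < m)
    {α : (ZMod q)ˣ} (hα : ¬ IsSquare (α : ZMod q)) :
    ‖twistDev α fun ℓ : (ZMod q)ˣ => squareCount x q m ℓ‖ ^ 2 ≤ √(2 * x / m) := by
  by_cases hmq : IsUnit (m : ZMod q)
  · obtain ⟨g, hg⟩ := hmq
    set u := ⌊√(x / m)⌋₊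
    set v := ⌊√(2 * x / m)⌋₊
    obtain ⟨κ, hκ⟩ := exists_sum_progSum_sub_sq_le (q := q) (u := u) (v := v) (w := fun _ => 1)
      (W := 1) (fun _ _ _ _ _ => le_rfl) (fun _ _ => zero_le_one) (fun _ _ => le_rfl) zero_le_one
    have hF : (fun ℓ : (ZMod q)ˣ => squareCount x q m ℓ) = fun ℓ =>
        ∑ t ∈ Finset.univ.filter fun t : (ZMod q)ˣ => t ^ 2 = ℓ * g⁻¹,
          progSum q u v (fun _ => 1) t := by
      funext ℓ
      unfold squareCount progSum
      simp only [← and_assoc]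
      rw [← Finset.sum_filter, ← Finset.filter_filter, filter_sq_mul_eq_Ioc hx hm]
      simp only [Finset.sum_filter]
      rw [Finset.sum_congr rfl fun t _ => show (if t ^ 2 = ℓ * g⁻¹ then ∑ a ∈ Finset.Ioc u v,
        if (a : ZMod q) = t then (1 : ℝ) else 0 else 0) = ∑ a ∈ Finset.Ioc u v,
        if t ^ 2 = ℓ * g⁻¹ then if (a : ZMod q) = t then (1 : ℝ) else 0 else 0 by
          split_ifs <;> simp, Finset.sum_comm]
      refine Finset.sum_congr rfl fun a _ => ?_
      by_cases ha : IsUnit (a : ZMod q)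
      · obtain ⟨s, hs⟩ := ha
        rw [Finset.sum_eq_single s (fun t _ hts => ?_) fun h => absurd (Finset.mem_univ _) h]
        · rw [if_pos hs.symm]
          refine if_congr ?_ rfl rfl
          rw [eq_mul_inv_iff_mul_eq, Units.ext_iff, Units.val_mul, Units.val_pow_eq_pow_val, hs,
            hg]
          push_cast
          rfl
        · have : (a : ZMod q) ≠ t := fun h => hts (Units.ext (h.symm.trans hs.symm))
          rw [if_neg this, ite_self]
      · rw [if_neg, Finset.sum_eq_zero fun t _ => ?_]
        · have : (a : ZMod q) ≠ t := fun h => ha (h ▸ t.isUnit)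
          rw [if_neg this, ite_self]
        · intro h
          push_cast at h
          exact ha ((isUnit_pow_iff two_ne_zero).1
            (isUnit_of_mul_isUnit_left (h ▸ ℓ.isUnit)))
    rw [hF]
    have hα1 : α ≠ 1 := by
      rintro rfl
      exact hα ⟨1, by simp⟩
    refine (norm_twistDev_sq_le_of_square_fibres hα1 (card_sq_eq_or_sq_eq_mul hα) g⁻¹
      (fun t => progSum q u v (fun _ => 1) t) κ).trans (hκ.trans ?_)
    rw [one_pow, one_mul]
    exact Nat.floor_le (Real.sqrt_nonneg _)
  · rw [twistDev_eq_zero]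
    · rw [norm_zero]
      have := Real.sqrt_nonneg (2 * x / m)
      simpa using this
    · intro ℓ
      refine Finset.sum_eq_zero fun a _ => if_neg fun h => hmq ?_
      have h3 := h.2.2
      push_cast at h3
      exact isUnit_of_mul_isUnit_right (h3 ▸ ℓ.isUnit)

theorem norm_twistDev_dilatedSum_sq_le {x : ℝ} (hx : 0 < x) {m : ℕ} (hm : 0 < m)
    (α : (ZMod q)ˣ) {w : ℕ → ℝ} (hw : AntitoneOn w (Set.Ici 1)) (hw0 : ∀ n, 0 ≤ w n)
    (hw1 : ∀ n : ℕ, 1 ≤ n → w n ≤ (√n)⁻¹) :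
    ‖twistDev α fun ℓ : (ZMod q)ˣ => dilatedSum x q m w ℓ‖ ^ 2 ≤ 2 := by
  by_cases hmq : IsUnit (m : ZMod q)
  · obtain ⟨g, hg⟩ := hmq
    have hm' : (0 : ℝ) < m := by exact_mod_cast hm
    set u := ⌊x / m⌋₊ with hu
    set v := ⌊2 * x / m⌋₊ with hv
    obtain ⟨κ, hκ⟩ := exists_sum_progSum_sub_sq_le (q := q) (u := u) (v := v) (w := w)
      (W := (√(x / m))⁻¹)
      (hw.mono fun n hn => Set.mem_Ici.2 (by have := hn.1; omega)) (fun n _ => hw0 n)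
      (fun n hn => by
        rw [Finset.mem_Ioc, hu, Nat.floor_lt (by positivity)] at hn
        have h1 : 1 ≤ n := by
          rcases Nat.eq_zero_or_pos n with rfl | h0
          · have := hn.1
            have : 0 < x / m := by positivity
            norm_num at hn
            linarith
          · exact h0
        refine (hw1 n h1).trans ?_
        have : 0 < √(x / m) := Real.sqrt_pos.2 (by positivity)
        gcongr
        exact hn.1.le) (by positivity)
    have hF : ∀ ℓ : (ZMod q)ˣ, dilatedSum x q m w ℓ =
        progSum q u v w ((ℓ * g⁻¹ : (ZMod q)ˣ) : ZMod q) := by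
      intro ℓ
      unfold dilatedSum progSum
      simp only [← and_assoc]
      rw [← Finset.sum_filter, ← Finset.filter_filter, filter_mul_eq_Ioc hx.le hm]
      refine Finset.sum_congr (Finset.filter_congr fun n _ => ?_) fun _ _ => rfl
      rw [Nat.cast_mul, ← hg, Units.val_mul, Units.eq_mul_inv_iff_mul_eq]
    refine (norm_twistDev_sq_le α _ κ).trans ?_
    simp only [hF]
    refine (Equiv.sum_comp (Equiv.mulRight g⁻¹)
      (fun t : (ZMod q)ˣ => (progSum q u v w (t : ZMod q) - κ) ^ 2)).le.trans (hκ.trans ?_)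
    calc (√(x / m))⁻¹ ^ 2 * v ≤ (√(x / m))⁻¹ ^ 2 * (2 * x / m) := by
          gcongr
          exact Nat.floor_le (by positivity)
      _ = 2 := by
          rw [inv_pow, Real.sq_sqrt (by positivity)]
          field_simp
  · rw [twistDev_eq_zero]
    · simp
    · intro ℓ
      refine Finset.sum_eq_zero fun a _ => if_neg fun h => hmq ?_
      have h3 := h.2.2
      push_cast at h3
      exact isUnit_of_mul_isUnit_right (h3 ▸ ℓ.isUnit)

end Pieces

section Decomposition

theorem dvd_iff_odd_factorization {a b : ℕ} (ha : a ≠ 0) (hb : Squarefree b) {p : ℕ}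
    (hp : p.Prime) : p ∣ b ↔ Odd ((a ^ 2 * b ^ 3).factorization p) := by
  have hb0 : b ≠ 0 := hb.ne_zero
  rw [Nat.factorization_mul (pow_ne_zero _ ha) (pow_ne_zero _ hb0), Nat.factorization_pow,
    Nat.factorization_pow]
  have h1 := (Nat.squarefree_iff_factorization_le_one hb0).1 hb p
  have h2 : p ∣ b ↔ 1 ≤ b.factorization p := hp.dvd_iff_one_le_factorization hb0
  simp only [Finsupp.add_apply, Finsupp.smul_apply, smul_eq_mul]
  rw [h2, Nat.odd_iff]
  omega

theorem sq_mul_cube_injective {a b a' b' : ℕ} (ha : a ≠ 0) (ha' : a' ≠ 0) (hb : Squarefree b)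
    (hb' : Squarefree b') (h : a ^ 2 * b ^ 3 = a' ^ 2 * b' ^ 3) : a = a' ∧ b = b' := by
  have hbb : b = b' := by
    rw [Nat.Squarefree.ext_iff hb hb']
    intro p hp
    rw [dvd_iff_odd_factorization ha hb hp, dvd_iff_odd_factorization ha' hb' hp, h]
  subst hbb
  have hb0 : 0 < b ^ 3 := pow_pos (Nat.pos_of_ne_zero hb.ne_zero) 3
  exact ⟨Nat.pow_left_injective two_ne_zero (Nat.eq_of_mul_eq_mul_right hb0 h), rfl⟩

theorem ind23_eq_sum {n M : ℕ} (hn : 1 ≤ n) (hM : n ≤ M) :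
    ind23 n = ∑ b ∈ (Finset.Icc 1 M).filter Squarefree, ∑ a ∈ Finset.Icc 1 M,
      if n = a ^ 2 * b ^ 3 then (1 : ℝ) else 0 := by
  rw [← Finset.sum_product', ind23]
  split_ifs with h
  · obtain ⟨a, b, ha, hb, rfl⟩ := h
    obtain ⟨s, d, hd, hs⟩ := Nat.sq_mul_squarefree b
    have hs0 : 0 < s := Nat.pos_of_ne_zero hs.ne_zero
    have hd0 : 0 < d := by
      rcases Nat.eq_zero_or_pos d with rfl | h
      · simp at hd; omega
      · exact h
    have hn' : a ^ 2 * b ^ 3 = (a * d ^ 3) ^ 2 * s ^ 3 := by rw [← hd]; ring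
    have had : 0 < a * d ^ 3 := by positivity
    rw [Finset.sum_eq_single (s, a * d ^ 3)]
    · rw [if_pos hn']
    · rintro ⟨b', a'⟩ hmem hne
      simp only [Finset.mem_product, Finset.mem_filter, Finset.mem_Icc] at hmem
      refine if_neg fun h => hne ?_
      obtain ⟨h1, h2⟩ := sq_mul_cube_injective (by omega) had.ne' hmem.1.2 hs (h.symm.trans hn')
      exact Prod.ext h2 h1
    · intro hmem
      refine absurd ?_ hmem
      simp only [Finset.mem_product, Finset.mem_filter, Finset.mem_Icc]
      rw [hn'] at hM
      have h3 : 1 ≤ s ^ 3 := Nat.one_le_pow _ _ hs0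
      have h4 : 1 ≤ (a * d ^ 3) ^ 2 := Nat.one_le_pow _ _ had
      have h5 : s ≤ s ^ 3 := Nat.le_self_pow (by norm_num) s
      have h6 : a * d ^ 3 ≤ (a * d ^ 3) ^ 2 := Nat.le_self_pow (by norm_num) _
      refine ⟨⟨⟨hs0, ?_⟩, hs⟩, had, ?_⟩ <;> nlinarith
  · refine (Finset.sum_eq_zero fun p hp => if_neg fun hn => h ?_).symm
    simp only [Finset.mem_product, Finset.mem_filter, Finset.mem_Icc] at hp
    exact ⟨p.2, p.1, by omega, by omega, hn⟩

variable {q : ℕ}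

theorem sum_ind23_eq (x : ℝ) {c : ℕ} (hc : 0 < c) (ℓ : ZMod q) :
    (∑ n ∈ Finset.Icc 1 ⌊2 * x⌋₊, if x < ((n * c ^ 6 : ℕ) : ℝ) ∧ ((n * c ^ 6 : ℕ) : ℝ) ≤ 2 * x ∧
        ((n * c ^ 6 : ℕ) : ZMod q) = ℓ then ind23 n else 0) =
      ∑ b ∈ (Finset.Icc 1 ⌊2 * x⌋₊).filter Squarefree, squareCount x q (b ^ 3 * c ^ 6) ℓ := by
  set N := ⌊2 * x⌋₊ with hN
  calc _ = ∑ n ∈ Finset.Icc 1 N, ∑ b ∈ (Finset.Icc 1 N).filter Squarefree, ∑ a ∈ Finset.Icc 1 N,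
        if n = a ^ 2 * b ^ 3 then (if x < ((n * c ^ 6 : ℕ) : ℝ) ∧ ((n * c ^ 6 : ℕ) : ℝ) ≤ 2 * x ∧
        ((n * c ^ 6 : ℕ) : ZMod q) = ℓ then (1 : ℝ) else 0) else 0 := by
        refine Finset.sum_congr rfl fun n hn => ?_
        rw [Finset.mem_Icc] at hn
        rw [ind23_eq_sum hn.1 hn.2]
        split_ifs
        · rfl
        · simp
    _ = _ := by
        rw [Finset.sum_comm]
        refine Finset.sum_congr rfl fun b hb => ?_
        rw [Finset.sum_comm]
        refine Finset.sum_congr rfl fun a ha => ?_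
        rw [Finset.sum_ite_eq' (Finset.Icc 1 N) (a ^ 2 * b ^ 3), mul_assoc]
        simp only [Finset.mem_filter, Finset.mem_Icc] at ha hb
        split_ifs with h1 h2 h2
        · rfl
        · rfl
        · refine absurd ?_ h1
          have hle : a ^ 2 * (b ^ 3 * c ^ 6) ≤ N := Nat.le_floor h2.2.1
          have h3 : 1 ≤ a ^ 2 := Nat.one_le_pow _ _ ha.1
          have h4 : 1 ≤ b ^ 3 := Nat.one_le_pow _ _ hb.1.1
          have h5 : 1 ≤ c ^ 6 := Nat.one_le_pow _ _ hc
          rw [Finset.mem_Icc]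
          refine ⟨Nat.mul_pos h3 h4, ?_⟩
          calc a ^ 2 * b ^ 3 ≤ a ^ 2 * b ^ 3 * c ^ 6 := Nat.le_mul_of_pos_right _ h5
            _ = a ^ 2 * (b ^ 3 * c ^ 6) := mul_assoc _ _ _
            _ ≤ N := hle
        · rfl

theorem Spr_eq_sum (x : ℝ) (ℓ : ZMod q) :
    Spr x q ℓ = ∑ c ∈ Finset.Icc 1 ⌊2 * x⌋₊, ((ArithmeticFunction.moebius c : ℤ) : ℝ) *
      ((∑ b ∈ (Finset.Icc 1 ⌊2 * x⌋₊).filter Squarefree, squareCount x q (b ^ 3 * c ^ 6) ℓ) -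
        zr (3 / 2) / 2 * dilatedSum x q (c ^ 6) (fun n => ((n : ℝ) ^ ((1 : ℝ) / 2))⁻¹) ℓ -
        zr (2 / 3) / 3 * dilatedSum x q (c ^ 6) (fun n => ((n : ℝ) ^ ((2 : ℝ) / 3))⁻¹) ℓ) := by
  unfold Spr
  rw [Finset.sum_comm]
  refine Finset.sum_congr rfl fun c hc => ?_
  rw [← sum_ind23_eq x (Finset.mem_Icc.1 hc).1, dilatedSum, dilatedSum, Finset.mul_sum,
    Finset.mul_sum, ← Finset.sum_sub_distrib, ← Finset.sum_sub_distrib, Finset.mul_sum]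
  refine Finset.sum_congr rfl fun n _ => ?_
  split_ifs
  · unfold rf fm
    ring
  · ring

variable [Fact q.Prime]

theorem sum_coprime_eq_sum_units {M : Type*} [AddCommMonoid M] (F : ZMod q → M) :
    ∑ ℓ ∈ (Finset.range q).filter (fun ℓ => Nat.Coprime ℓ q), F (ℓ : ZMod q) =
      ∑ t : (ZMod q)ˣ, F t := by
  have hq := (Fact.out : q.Prime).pos
  refine Finset.sum_bij' (fun ℓ hℓ => ZMod.unitOfCoprime ℓ (Finset.mem_filter.1 hℓ).2)
    (fun t _ => (t : ZMod q).val) (fun _ _ => Finset.mem_univ _) (fun t _ => ?_)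
    (fun ℓ hℓ => ?_) (fun t _ => ?_) (fun ℓ hℓ => ?_)
  · exact Finset.mem_filter.2 ⟨Finset.mem_range.2 (ZMod.val_lt _), ZMod.val_coe_unit_coprime t⟩
  · rw [ZMod.coe_unitOfCoprime]
    exact ZMod.val_cast_of_lt (Finset.mem_range.1 (Finset.mem_filter.1 hℓ).1)
  · ext
    rw [ZMod.coe_unitOfCoprime, ZMod.natCast_zmod_val]
  · rw [ZMod.coe_unitOfCoprime]

theorem SprCop_eq_sum (x : ℝ) : SprCop x q = ∑ t : (ZMod q)ˣ, Spr x q t := by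
  unfold SprCop Spr
  symm
  rw [Finset.sum_comm]
  refine Finset.sum_congr rfl fun n _ => ?_
  rw [Finset.sum_comm]
  refine Finset.sum_congr rfl fun c _ => ?_
  symm
  by_cases h : Nat.Coprime (n * c ^ 6) q
  · rw [Finset.sum_eq_single (ZMod.unitOfCoprime _ h) (fun t _ ht => ?_)
      fun h => absurd (Finset.mem_univ _) h]
    · refine if_congr ?_ rfl rfl
      rw [ZMod.coe_unitOfCoprime, eq_self_iff_true, iff_true_intro h]
    · refine if_neg fun h' => ht (Units.ext ?_)
      rw [ZMod.coe_unitOfCoprime]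
      exact h'.2.2.symm
  · rw [if_neg fun h' => h h'.2.2]
    refine (Finset.sum_eq_zero fun t _ => if_neg fun h' => h ?_).symm
    rw [← ZMod.isUnit_iff_coprime, h'.2.2]
    exact t.isUnit

theorem mean_square_deviation_eq (x : ℝ) {α : ℕ} {u : (ZMod q)ˣ} (hu : (u : ZMod q) = α) :
    (∑ ℓ ∈ (Finset.range q).filter (fun ℓ => Nat.Coprime ℓ q),
      |(1 / 2) * (Spr x q ((ℓ : ℕ) : ZMod q) + Spr x q ((α * ℓ : ℕ) : ZMod q)) -
        (1 / (q.totient : ℝ)) * SprCop x q| ^ 2) =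
      ‖twistDev u fun t : (ZMod q)ˣ => Spr x q t‖ ^ 2 := by
  rw [norm_twistDev_sq, SprCop_eq_sum, ZMod.card_units_eq_totient]
  simp only [Nat.cast_mul, ← hu, sq_abs]
  rw [sum_coprime_eq_sum_units (q := q) fun ℓ => ((1 / 2) * (Spr x q ℓ + Spr x q (u * ℓ)) -
        (1 / (q.totient : ℝ)) * ∑ t : (ZMod q)ˣ, Spr x q t) ^ 2]
  refine Finset.sum_congr rfl fun t _ => ?_
  rw [Units.val_mul]
  ring

end Decomposition

section DyadicBlocks

variable {q : ℕ}

theorem sum_squareCount_le_card {x : ℝ} {c B : ℕ} (hx : 0 ≤ x) (hB : 1 ≤ B) (hc : 1 ≤ c)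
    {S : Finset ℕ} (hS : ∀ b ∈ S, B ≤ b ∧ b ≤ 2 * B) {g : (ZMod q)ˣ} (hg : (g : ZMod q) = c)
    (ℓ : (ZMod q)ˣ) :
    ∑ b ∈ S, squareCount x q (b ^ 3 * c ^ 6) ℓ ≤
      (((Finset.Icc 1 ⌊√(2 * x / ((B : ℝ) ^ 3 * (c : ℝ) ^ 6))⌋₊ ×ˢ Finset.Icc 1 (2 * B)).filter
        fun p : ℕ × ℕ => (p.1 : ZMod q) ^ 2 * (p.2 : ZMod q) ^ 3 =
          ((ℓ * (g ^ 6)⁻¹ : (ZMod q)ˣ) : ZMod q)).card : ℝ) := by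
  unfold squareCount
  rw [← Finset.sum_product', ← Finset.sum_filter, Finset.sum_const, nsmul_eq_mul, mul_one]
  refine Nat.cast_le.2 ?_
  refine Finset.card_le_card_of_injOn Prod.swap ?_ (Prod.swap_injective.injOn)
  rintro ⟨b, a⟩ hp
  simp only [Finset.coe_filter, Finset.mem_product, Finset.mem_Icc, Set.mem_ofPred_eq,
    Prod.swap_prod_mk] at hp ⊢
  obtain ⟨⟨hb, ha, -⟩, -, h2, h3⟩ := hp
  obtain ⟨hb1, hb2⟩ := hS b hb
  refine ⟨⟨⟨ha, ?_⟩, hB.trans hb1, hb2⟩, ?_⟩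
  · have hB' : (0 : ℝ) < B := by exact_mod_cast hB
    have hc' : (0 : ℝ) < c := by exact_mod_cast hc
    rw [Nat.le_floor_iff (Real.sqrt_nonneg _), Real.le_sqrt (by positivity) (by positivity),
      le_div_iff₀ (by positivity)]
    push_cast at h2
    refine le_trans ?_ h2
    have : (B : ℝ) ≤ b := by exact_mod_cast hb1
    gcongr
  · rw [Units.val_mul, Units.eq_mul_inv_iff_mul_eq, Units.val_pow_eq_pow_val, hg, mul_assoc]
    push_cast at h3
    exact h3

theorem exists_norm_twistDev_block_sq_le {k : ℕ} (hk : 2 ≤ k) {δ : ℝ} (hδ : 0 < δ) :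
    ∃ C : ℝ, 0 < C ∧ ∀ (q : ℕ) [Fact q.Prime] (α : (ZMod q)ˣ) (x : ℝ) (c B : ℕ) (S : Finset ℕ),
      0 ≤ x → 1 ≤ c → 1 ≤ B → (∀ b ∈ S, B ≤ b ∧ b ≤ 2 * B) →
      ‖twistDev α fun ℓ : (ZMod q)ˣ => ∑ b ∈ S, squareCount x q (b ^ 3 * c ^ 6) ℓ‖ ^ 2 ≤
        C * x ^ δ * (√(2 * x / (B : ℝ) ^ 3) * (2 * B) * (√(2 * x / (B : ℝ) ^ 3) / q + 1) *
          (√(2 * x / (B : ℝ) ^ 3) ^ 2 / q + 1) ^ (1 / k : ℝ) *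
          ((2 * B : ℝ) ^ k / q + 1) ^ (1 / k : ℝ)) / (c : ℝ) ^ 3 := by
  obtain ⟨C, hC, hmain⟩ := exists_sum_card_sq_le hk hδ
  refine ⟨C * 4 ^ δ, by positivity, ?_⟩
  intro q _ α x c B S hx hc hB hS
  have hB' : (0 : ℝ) < B := by exact_mod_cast hB
  have hc' : (1 : ℝ) ≤ c := by exact_mod_cast hc
  have hrhs : 0 ≤ C * 4 ^ δ * x ^ δ * (√(2 * x / (B : ℝ) ^ 3) * (2 * B) *
      (√(2 * x / (B : ℝ) ^ 3) / q + 1) * (√(2 * x / (B : ℝ) ^ 3) ^ 2 / q + 1) ^ (1 / k : ℝ) *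
      ((2 * B : ℝ) ^ k / q + 1) ^ (1 / k : ℝ)) / (c : ℝ) ^ 3 := by positivity
  by_cases hcq : IsUnit (c : ZMod q)
  swap
  · rw [twistDev_eq_zero, norm_zero]
    · simpa using hrhs
    · intro ℓ
      refine Finset.sum_eq_zero fun b _ => Finset.sum_eq_zero fun a _ => if_neg fun h => hcq ?_
      have h3 := h.2.2
      push_cast at h3
      exact (isUnit_pow_iff (by norm_num)).1
        (isUnit_of_mul_isUnit_right (isUnit_of_mul_isUnit_right (h3 ▸ ℓ.isUnit)))
  obtain ⟨g, hg⟩ := hcq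
  set A := ⌊√(2 * x / ((B : ℝ) ^ 3 * (c : ℝ) ^ 6))⌋₊ with hA
  have hcard := fun ℓ => sum_squareCount_le_card hx hB hc hS hg ℓ
  rw [← hA] at hcard
  have hG0 : ∀ ℓ : (ZMod q)ˣ, 0 ≤ ∑ b ∈ S, squareCount x q (b ^ 3 * c ^ 6) ℓ :=
    fun ℓ => Finset.sum_nonneg fun b _ => squareCount_nonneg _ _ _ _
  rcases Nat.eq_zero_or_pos A with h0 | hA1
  · rw [twistDev_eq_zero, norm_zero]
    · simpa using hrhs
    · intro ℓ
      refine le_antisymm ((hcard ℓ).trans (le_of_eq ?_)) (hG0 ℓ)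
      rw [h0]
      simp
  have hsqrt : √(2 * x / ((B : ℝ) ^ 3 * (c : ℝ) ^ 6)) = √(2 * x / (B : ℝ) ^ 3) / (c : ℝ) ^ 3 := by
    rw [← div_div, Real.sqrt_div (by positivity), show (c : ℝ) ^ 6 = ((c : ℝ) ^ 3) ^ 2 by ring,
      Real.sqrt_sq (by positivity)]
  set P := √(2 * x / (B : ℝ) ^ 3) with hP
  have hP0 : 0 ≤ P := Real.sqrt_nonneg _
  have hAP : (A : ℝ) ≤ P / (c : ℝ) ^ 3 := by
    rw [← hsqrt]
    exact Nat.floor_le (Real.sqrt_nonneg _)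
  have hAP' : (A : ℝ) ≤ P := hAP.trans (div_le_self hP0 (one_le_pow₀ hc'))
  have hP1 : 1 ≤ P := le_trans (by exact_mod_cast hA1) hAP'
  have hB1 : (1 : ℝ) ≤ B := by exact_mod_cast hB
  have hPx : 1 ≤ 2 * x / (B : ℝ) ^ 3 := by
    have := Real.sq_sqrt (show 0 ≤ 2 * x / (B : ℝ) ^ 3 by positivity)
    rw [← hP] at this
    nlinarith
  have hBx : (B : ℝ) ^ 3 ≤ 2 * x := by
    rwa [le_div_iff₀ (by positivity), one_mul] at hPx
  have hBx' : (B : ℝ) ≤ 2 * x := (le_self_pow₀ hB1 (by norm_num)).trans hBx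
  have hPx' : P ≤ 2 * x := by
    have h1 : P ≤ P ^ 2 := le_self_pow₀ hP1 (by norm_num)
    have h2 : P ^ 2 = 2 * x / (B : ℝ) ^ 3 := Real.sq_sqrt (by positivity)
    have h3 : 2 * x / (B : ℝ) ^ 3 ≤ 2 * x := div_le_self (by positivity) (one_le_pow₀ hB1)
    linarith
  refine (norm_twistDev_sq_le α _ 0).trans ?_
  have hstep : ∑ ℓ : (ZMod q)ˣ, ((∑ b ∈ S, squareCount x q (b ^ 3 * c ^ 6) ℓ) - 0) ^ 2 ≤
      ∑ ℓ : (ZMod q)ˣ, (((Finset.Icc 1 A ×ˢ Finset.Icc 1 (2 * B)).filter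
        fun p : ℕ × ℕ => (p.1 : ZMod q) ^ 2 * (p.2 : ZMod q) ^ 3 =
          ((ℓ * (g ^ 6)⁻¹ : (ZMod q)ˣ) : ZMod q)).card : ℝ) ^ 2 := by
    refine Finset.sum_le_sum fun ℓ _ => ?_
    rw [sub_zero]
    exact pow_le_pow_left₀ (hG0 ℓ) (hcard ℓ) 2
  refine hstep.trans ?_
  refine (Equiv.sum_comp (Equiv.mulRight (g ^ 6)⁻¹)
    (fun t : (ZMod q)ˣ => (((Finset.Icc 1 A ×ˢ Finset.Icc 1 (2 * B)).filter
      fun p : ℕ × ℕ => (p.1 : ZMod q) ^ 2 * (p.2 : ZMod q) ^ 3 = (t : ZMod q)).card : ℝ) ^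
        2)).le.trans ((hmain q A (2 * B) (4 * x) hA1 (by omega) (by linarith)
      (by push_cast; linarith)).trans ?_)
  rw [Real.mul_rpow (by norm_num) hx]
  push_cast
  calc C * (4 ^ δ * x ^ δ) * ((A : ℝ) * (2 * B) * (A / q + 1) *
        ((A : ℝ) ^ 2 / q + 1) ^ (1 / k : ℝ) * ((2 * B : ℝ) ^ k / q + 1) ^ (1 / k : ℝ))
      ≤ C * (4 ^ δ * x ^ δ) * (P / (c : ℝ) ^ 3 * (2 * B) * (P / q + 1) *
        (P ^ 2 / q + 1) ^ (1 / k : ℝ) * ((2 * B : ℝ) ^ k / q + 1) ^ (1 / k : ℝ)) := by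
        gcongr
    _ = _ := by ring

end DyadicBlocks

section Exponents

theorem rpow_add_one_le {y p : ℝ} (hy : 0 ≤ y) (hp0 : 0 ≤ p) (hp1 : p ≤ 1) :
    (y + 1) ^ p ≤ y ^ p + 1 := by
  simpa using Real.rpow_add_le_add_rpow hy zero_le_one hp0 hp1

theorem product_le_rpow {k : ℕ} (hk : 1 ≤ k) {x P D β θ E : ℝ} (hx : 1 ≤ x) (hP0 : 0 ≤ P)
    (hD0 : 0 ≤ D) (hP : P ≤ 4 * x ^ ((1 - 3 * β) / 2)) (hD : D ≤ 4 * x ^ β)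
    (h0 : (1 - 3 * β) / 2 ≤ θ) (h1 : (1 - β) / 2 ≤ E)
    (h2 : (1 - β) / 2 + (1 - 3 * β - θ) / k ≤ E) (h3 : (1 - β) / 2 + (β - θ / k) ≤ E)
    (h4 : (1 - β) / 2 + (1 - 3 * β - θ) / k + (β - θ / k) ≤ E) :
    P * D * (P / x ^ θ + 1) * (P ^ 2 / x ^ θ + 1) ^ (1 / k : ℝ) *
      (D ^ k / x ^ θ + 1) ^ (1 / k : ℝ) ≤ 20480 * x ^ E := by
  have hx0 : 0 < x := by linarith
  have hk' : (1 : ℝ) ≤ k := by exact_mod_cast hk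
  have hk0 : (0 : ℝ) ≤ 1 / k := by positivity
  have hk1 : (1 / k : ℝ) ≤ 1 := by rw [div_le_one (by linarith)]; exact hk'
  have hmul : P * D ≤ 16 * x ^ ((1 - β) / 2) := by
    calc P * D ≤ (4 * x ^ ((1 - 3 * β) / 2)) * (4 * x ^ β) := by gcongr
      _ = 16 * (x ^ ((1 - 3 * β) / 2) * x ^ β) := by ring
      _ = 16 * x ^ ((1 - β) / 2) := by rw [← Real.rpow_add hx0]; ring_nf
  have hA : P / x ^ θ + 1 ≤ 5 := by
    have : P / x ^ θ ≤ 4 := by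
      rw [div_le_iff₀ (by positivity)]
      exact hP.trans (by gcongr)
    linarith
  have hB : (P ^ 2 / x ^ θ + 1) ^ (1 / k : ℝ) ≤ 16 * (x ^ ((1 - 3 * β - θ) / k) + 1) := by
    calc (P ^ 2 / x ^ θ + 1) ^ (1 / k : ℝ)
        ≤ ((4 * x ^ ((1 - 3 * β) / 2)) ^ 2 / x ^ θ + 1) ^ (1 / k : ℝ) := by gcongr
      _ = (16 * x ^ (1 - 3 * β - θ) + 1) ^ (1 / k : ℝ) := by
          rw [mul_pow, ← Real.rpow_mul_natCast hx0.le, mul_div_assoc, ← Real.rpow_sub hx0]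
          norm_num
      _ ≤ (16 * x ^ (1 - 3 * β - θ)) ^ (1 / k : ℝ) + 1 := rpow_add_one_le (by positivity) hk0 hk1
      _ = 16 ^ (1 / k : ℝ) * x ^ ((1 - 3 * β - θ) / k) + 1 := by
          rw [Real.mul_rpow (by norm_num) (by positivity), ← Real.rpow_mul hx0.le, mul_one_div]
      _ ≤ 16 ^ (1 : ℝ) * x ^ ((1 - 3 * β - θ) / k) + 1 := by
          gcongr
          norm_num
      _ ≤ 16 * (x ^ ((1 - 3 * β - θ) / k) + 1) := by rw [Real.rpow_one]; linarith
  have hC : (D ^ k / x ^ θ + 1) ^ (1 / k : ℝ) ≤ 4 * (x ^ (β - θ / k) + 1) := by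
    calc (D ^ k / x ^ θ + 1) ^ (1 / k : ℝ)
        ≤ ((4 * x ^ β) ^ k / x ^ θ + 1) ^ (1 / k : ℝ) := by gcongr
      _ ≤ ((4 * x ^ β) ^ k / x ^ θ) ^ (1 / k : ℝ) + 1 := rpow_add_one_le (by positivity) hk0 hk1
      _ = 4 * x ^ (β - θ / k) + 1 := by
          rw [Real.div_rpow (by positivity) (by positivity), one_div,
            Real.pow_rpow_inv_natCast (by positivity) (by omega), ← Real.rpow_mul hx0.le,
            Real.rpow_sub hx0, div_eq_mul_inv θ, mul_div_assoc]
      _ ≤ 4 * (x ^ (β - θ / k) + 1) := by linarith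
  have hmono : ∀ e, e ≤ E → x ^ e ≤ x ^ E := fun e he => Real.rpow_le_rpow_of_exponent_le hx he
  calc P * D * (P / x ^ θ + 1) * (P ^ 2 / x ^ θ + 1) ^ (1 / k : ℝ) *
        (D ^ k / x ^ θ + 1) ^ (1 / k : ℝ)
      ≤ 16 * x ^ ((1 - β) / 2) * 5 * (16 * (x ^ ((1 - 3 * β - θ) / k) + 1)) *
        (4 * (x ^ (β - θ / k) + 1)) := by gcongr
    _ = 5120 * (x ^ ((1 - β) / 2) + x ^ ((1 - β) / 2) * x ^ ((1 - 3 * β - θ) / k) +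
        x ^ ((1 - β) / 2) * x ^ (β - θ / k) +
        x ^ ((1 - β) / 2) * x ^ ((1 - 3 * β - θ) / k) * x ^ (β - θ / k)) := by ring
    _ ≤ 5120 * (x ^ E + x ^ E + x ^ E + x ^ E) := by
        simp only [← Real.rpow_add hx0]
        gcongr
    _ = 20480 * x ^ E := by ring

theorem exists_rpow_cap {x D : ℝ} (hx : 1 < x) (hD1 : x ^ (0.07 : ℝ) ≤ D)
    (hD3 : D ^ 3 ≤ 16 * x) :
    ∃ β : ℝ, 0.07 ≤ β ∧ β ≤ 1 / 3 ∧ x ^ β ≤ D ∧ D ≤ 4 * x ^ β := by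
  have hx0 : 0 < x := by linarith
  have hD0 : 0 < D := lt_of_lt_of_le (by positivity) hD1
  rcases le_total D (x ^ (1 / 3 : ℝ)) with h | h
  · have hpow : x ^ Real.logb x D = D := Real.rpow_logb hx0 hx.ne' hD0
    refine ⟨Real.logb x D, ?_, ?_, hpow.le, by rw [hpow]; linarith⟩
    · rwa [Real.le_logb_iff_rpow_le hx hD0]
    · rwa [Real.logb_le_iff_le_rpow hx hD0]
  · refine ⟨1 / 3, by norm_num, le_rfl, h, ?_⟩
    refine le_of_pow_le_pow_left₀ (n := 3) (by norm_num) (by positivity) (hD3.trans ?_)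
    rw [mul_pow, ← Real.rpow_mul_natCast hx0.le]
    norm_num
    linarith

theorem exists_exponent_le {x D P θ : ℝ} (hx : 1 < x) (hθ : 17 / 38 ≤ θ)
    (hD1 : x ^ (0.07 : ℝ) ≤ D) (hD3 : D ^ 3 ≤ 16 * x) (hP0 : 0 ≤ P)
    (hP : P ^ 2 * D ^ 3 ≤ 16 * x) :
    ∃ k : ℕ, (k = 3 ∨ k = 5) ∧ P * D * (P / x ^ θ + 1) * (P ^ 2 / x ^ θ + 1) ^ (1 / k : ℝ) *
      (D ^ k / x ^ θ + 1) ^ (1 / k : ℝ) ≤ 20480 * x ^ (5 * θ / 6 + 1 / 6 - 0.004) := by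
  have hx0 : 0 < x := by linarith
  obtain ⟨β, h1, h2, h3, h4⟩ := exists_rpow_cap hx hD1 hD3
  have hD0 : 0 < D := lt_of_lt_of_le (by positivity) h3
  have hP' : P ≤ 4 * x ^ ((1 - 3 * β) / 2) := by
    refine le_of_pow_le_pow_left₀ (n := 2) (by norm_num) (by positivity) ?_
    rw [mul_pow, ← Real.rpow_mul_natCast hx0.le]
    have hb : x ^ (3 * β) ≤ D ^ 3 := by
      calc x ^ (3 * β) = (x ^ β) ^ 3 := by
            rw [← Real.rpow_mul_natCast hx0.le]; push_cast; ring_nf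
        _ ≤ D ^ 3 := by gcongr
    have : P ^ 2 * x ^ (3 * β) ≤ 16 * x := le_trans (by gcongr) hP
    rw [← le_div_iff₀ (by positivity)] at this
    refine this.trans (le_of_eq ?_)
    rw [show (1 - 3 * β) / 2 * ((2 : ℕ) : ℝ) = 1 - 3 * β by push_cast; ring, Real.rpow_sub hx0,
      Real.rpow_one]
    ring
  rcases le_total β 0.1 with hβ | hβ
  · refine ⟨5, Or.inr rfl, product_le_rpow (by norm_num) hx.le hP0 hD0.le hP' h4 ?_ ?_ ?_ ?_ ?_⟩ <;>
      norm_num at * <;> linarith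
  · refine ⟨3, Or.inl rfl, product_le_rpow (by norm_num) hx.le hP0 hD0.le hP' h4 ?_ ?_ ?_ ?_ ?_⟩ <;>
      norm_num at * <;> linarith

end Exponents

section LargeCubes

theorem exists_norm_twistDev_block_le :
    ∃ C : ℝ, 0 < C ∧ ∀ (q : ℕ) [Fact q.Prime] (α : (ZMod q)ˣ) (x θ : ℝ) (c B : ℕ) (S : Finset ℕ),
      1 < x → (q : ℝ) = x ^ θ → 17 / 38 ≤ θ → 1 ≤ c → 1 ≤ B → x ^ (0.07 : ℝ) ≤ 2 * B →
      (∀ b ∈ S, B ≤ b ∧ b ≤ 2 * B) →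
      ‖twistDev α fun ℓ : (ZMod q)ˣ => ∑ b ∈ S, squareCount x q (b ^ 3 * c ^ 6) ℓ‖ ≤
        C * x ^ ((5 * θ / 6 + 1 / 6 - 0.003) / 2) * (c : ℝ) ^ (-(3 / 2) : ℝ) := by
  obtain ⟨C₃, hC₃, h₃⟩ := exists_norm_twistDev_block_sq_le (k := 3) (by norm_num)
    (δ := 0.001) (by norm_num)
  obtain ⟨C₅, hC₅, h₅⟩ := exists_norm_twistDev_block_sq_le (k := 5) (by norm_num)
    (δ := 0.001) (by norm_num)
  refine ⟨√((C₃ + C₅) * 20480), by positivity, ?_⟩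
  intro q _ α x θ c B S hx hq hθ hc hB hBx hS
  have hx0 : 0 < x := by linarith
  have hB0 : (0 : ℝ) < B := by exact_mod_cast hB
  have hc0 : (0 : ℝ) < c := by exact_mod_cast hc
  by_cases hBx3 : (B : ℝ) ^ 3 ≤ 2 * x
  swap
  · rw [twistDev_eq_zero, norm_zero]
    · positivity
    · refine fun ℓ => Finset.sum_eq_zero fun b hb => Finset.sum_eq_zero fun a ha =>
        if_neg fun h => hBx3 (le_trans ?_ h.2.1)
      have h1 : B ^ 3 ≤ a ^ 2 * (b ^ 3 * c ^ 6) := by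
        calc B ^ 3 ≤ b ^ 3 := Nat.pow_le_pow_left (hS b hb).1 3
          _ ≤ b ^ 3 * c ^ 6 := Nat.le_mul_of_pos_right _ (by positivity)
          _ ≤ a ^ 2 * (b ^ 3 * c ^ 6) :=
            Nat.le_mul_of_pos_left _ (pow_pos (Finset.mem_Icc.1 ha).1 2)
      exact_mod_cast h1
  obtain ⟨k, hk, hle⟩ := exists_exponent_le (D := 2 * B) (P := √(2 * x / (B : ℝ) ^ 3)) hx hθ hBx
    (by nlinarith) (Real.sqrt_nonneg _) (by
      rw [Real.sq_sqrt (by positivity)]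
      field_simp
      norm_num)
  rw [← hq] at hle
  have hkey : ‖twistDev α fun ℓ : (ZMod q)ˣ => ∑ b ∈ S, squareCount x q (b ^ 3 * c ^ 6) ℓ‖ ^ 2 ≤
      (C₃ + C₅) * x ^ (0.001 : ℝ) * (20480 * x ^ (5 * θ / 6 + 1 / 6 - 0.004)) / (c : ℝ) ^ 3 := by
    rcases hk with rfl | rfl
    · refine (h₃ q α x c B S hx0.le hc hB hS).trans ?_
      gcongr
      linarith
    · refine (h₅ q α x c B S hx0.le hc hB hS).trans ?_
      gcongr
      linarith
  refine le_of_pow_le_pow_left₀ (n := 2) (by norm_num) (by positivity) (hkey.trans (le_of_eq ?_))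
  rw [mul_pow, mul_pow, Real.sq_sqrt (by positivity), ← Real.rpow_mul_natCast hx0.le,
    ← Real.rpow_mul_natCast hc0.le]
  have e1 : x ^ ((5 * θ / 6 + 1 / 6 - 0.003) / 2 * ((2 : ℕ) : ℝ)) =
      x ^ (0.001 : ℝ) * x ^ (5 * θ / 6 + 1 / 6 - 0.004) := by
    rw [← Real.rpow_add hx0]
    congr 1
    push_cast
    ring
  have e2 : (c : ℝ) ^ (-(3 / 2) * ((2 : ℕ) : ℝ)) = ((c : ℝ) ^ 3)⁻¹ := by
    rw [← Real.rpow_natCast, ← Real.rpow_neg hc0.le]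
    norm_num
  rw [e1, e2]
  ring

theorem natLog_add_one_le {x : ℝ} (hx : 1 ≤ x) {N : ℕ} (hN : (N : ℝ) ≤ 2 * x) :
    ((Nat.log 2 N + 1 : ℕ) : ℝ) ≤ 8001 * x ^ (0.0005 : ℝ) := by
  have hx0 : 0 < x := by linarith
  have h1 : (1 : ℝ) ≤ x ^ (0.0005 : ℝ) := Real.one_le_rpow hx (by norm_num)
  have hlog : (Nat.log 2 N : ℝ) * Real.log 2 ≤ Real.log (2 * x) := by
    rcases Nat.eq_zero_or_pos N with rfl | h0
    · simp only [Nat.log_zero_right, Nat.cast_zero, zero_mul]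
      exact Real.log_nonneg (by linarith)
    · rw [← Real.log_pow]
      refine Real.log_le_log (by positivity) (le_trans ?_ hN)
      exact_mod_cast Nat.pow_log_le_self 2 h0.ne'
  have h2 : Real.log (2 * x) ≤ (2 * x) ^ (0.0005 : ℝ) / 0.0005 :=
    Real.log_le_rpow_div (by positivity) (by norm_num)
  have h3 : (2 * x) ^ (0.0005 : ℝ) ≤ 2 * x ^ (0.0005 : ℝ) := by
    rw [Real.mul_rpow (by norm_num) hx0.le]
    gcongr
    calc (2 : ℝ) ^ (0.0005 : ℝ) ≤ 2 ^ (1 : ℝ) :=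
          Real.rpow_le_rpow_of_exponent_le (by norm_num) (by norm_num)
      _ = 2 := Real.rpow_one 2
  have h4 : (0.5 : ℝ) ≤ Real.log 2 := by linarith [Real.log_two_gt_d9]
  have h5 : (Nat.log 2 N : ℝ) * 0.5 ≤ (Nat.log 2 N : ℝ) * Real.log 2 := by gcongr
  push_cast
  norm_num at h2 h5 h1 h3 ⊢
  linarith

theorem exists_norm_twistDev_large_le :
    ∃ C : ℝ, 0 < C ∧ ∀ (q : ℕ) [Fact q.Prime] (α : (ZMod q)ˣ) (x θ : ℝ) (c N : ℕ) (S : Finset ℕ),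
      1 < x → (q : ℝ) = x ^ θ → 17 / 38 ≤ θ → 1 ≤ c → (N : ℝ) ≤ 2 * x →
      (∀ b ∈ S, 1 ≤ b ∧ b ≤ N ∧ x ^ (0.07 : ℝ) < b) →
      ‖twistDev α fun ℓ : (ZMod q)ˣ => ∑ b ∈ S, squareCount x q (b ^ 3 * c ^ 6) ℓ‖ ≤
        C * x ^ ((5 * θ / 6 + 1 / 6 - 0.002) / 2) * (c : ℝ) ^ (-(3 / 2) : ℝ) := by
  obtain ⟨C, hC, hblock⟩ := exists_norm_twistDev_block_le
  refine ⟨8001 * C, by positivity, ?_⟩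
  intro q _ α x θ c N S hx hq hθ hc hN hS
  have hx0 : 0 < x := by linarith
  have hmaps : ∀ b ∈ S, Nat.log 2 b ∈ Finset.range (Nat.log 2 N + 1) := fun b hb =>
    Finset.mem_range.2 (Nat.lt_succ_of_le (Nat.log_mono_right (hS b hb).2.1))
  have hsplit : (fun ℓ : (ZMod q)ˣ => ∑ b ∈ S, squareCount x q (b ^ 3 * c ^ 6) ℓ) =
      ∑ j ∈ Finset.range (Nat.log 2 N + 1), fun ℓ : (ZMod q)ˣ =>
        ∑ b ∈ S.filter (fun b => Nat.log 2 b = j), squareCount x q (b ^ 3 * c ^ 6) ℓ := by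
    funext ℓ
    rw [Finset.sum_apply, Finset.sum_fiberwise_of_maps_to hmaps]
  rw [hsplit, map_sum]
  set R := C * x ^ ((5 * θ / 6 + 1 / 6 - 0.003) / 2) * (c : ℝ) ^ (-(3 / 2) : ℝ) with hR
  have hR0 : 0 ≤ R := by positivity
  have hterm : ∀ j ∈ Finset.range (Nat.log 2 N + 1), ‖twistDev α fun ℓ : (ZMod q)ˣ =>
      ∑ b ∈ S.filter (fun b => Nat.log 2 b = j), squareCount x q (b ^ 3 * c ^ 6) ℓ‖ ≤ R := by
    intro j _
    have hmem : ∀ b ∈ S.filter (fun b => Nat.log 2 b = j), 2 ^ j ≤ b ∧ b ≤ 2 * 2 ^ j := by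
      intro b hb
      obtain ⟨hbS, rfl⟩ := Finset.mem_filter.1 hb
      refine ⟨Nat.pow_log_le_self 2 (by have := (hS b hbS).1; omega), ?_⟩
      have := Nat.lt_pow_succ_log_self (b := 2) (by norm_num) b
      rw [Nat.succ_eq_add_one, pow_succ] at this
      omega
    rcases (S.filter (fun b => Nat.log 2 b = j)).eq_empty_or_nonempty with he | ⟨b, hb⟩
    · rw [he, twistDev_eq_zero, norm_zero]
      · exact hR0
      · simp
    · refine hblock q α x θ c (2 ^ j) _ hx hq hθ hc Nat.one_le_two_pow ?_ hmem
      have h1 : (b : ℝ) ≤ ((2 * 2 ^ j : ℕ) : ℝ) := by exact_mod_cast (hmem b hb).2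
      rw [Nat.cast_mul, Nat.cast_ofNat] at h1
      exact (hS b (Finset.mem_filter.1 hb).1).2.2.le.trans h1
  calc _ ≤ ∑ j ∈ Finset.range (Nat.log 2 N + 1), R := norm_sum_le_of_le _ hterm
    _ = ((Nat.log 2 N + 1 : ℕ) : ℝ) * R := by rw [Finset.sum_const, Finset.card_range, nsmul_eq_mul]
    _ ≤ 8001 * x ^ (0.0005 : ℝ) * R := by
        gcongr
        exact natLog_add_one_le hx.le hN
    _ = 8001 * C * (x ^ (0.0005 : ℝ) * x ^ ((5 * θ / 6 + 1 / 6 - 0.003) / 2)) *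
        (c : ℝ) ^ (-(3 / 2) : ℝ) := by rw [hR]; ring
    _ = _ := by
        rw [← Real.rpow_add hx0]
        ring_nf

end LargeCubes

section Assembly

theorem norm_twistDev_squareCount_le {q : ℕ} [Fact q.Prime] {α : (ZMod q)ˣ}
    (hα : ¬ IsSquare (α : ZMod q)) {x : ℝ} (hx : 0 < x) {b c : ℕ} (hb : 1 ≤ b) (hc : 1 ≤ c) :
    ‖twistDev α fun ℓ : (ZMod q)ˣ => squareCount x q (b ^ 3 * c ^ 6) ℓ‖ ≤
      2 * x ^ (1 / 4 : ℝ) * (b : ℝ) ^ (-(3 / 4) : ℝ) * (c : ℝ) ^ (-(3 / 2) : ℝ) := by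
  have hb0 : (0 : ℝ) < b := by exact_mod_cast hb
  have hc0 : (0 : ℝ) < c := by exact_mod_cast hc
  refine le_of_pow_le_pow_left₀ (n := 2) (by norm_num) (by positivity)
    ((norm_twistDev_squareCount_sq_le hx.le (by positivity) hα).trans ?_)
  rw [Real.sqrt_le_left (by positivity), ← pow_mul, mul_pow, mul_pow, mul_pow,
    ← Real.rpow_mul_natCast hx.le, ← Real.rpow_mul_natCast hb0.le, ← Real.rpow_mul_natCast hc0.le]
  have e1 : x ^ (1 / 4 * ((2 * 2 : ℕ) : ℝ)) = x := by norm_num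
  have e2 : (b : ℝ) ^ (-(3 / 4) * ((2 * 2 : ℕ) : ℝ)) = ((b : ℝ) ^ 3)⁻¹ := by
    rw [← Real.rpow_natCast, ← Real.rpow_neg hb0.le]
    norm_num
  have e3 : (c : ℝ) ^ (-(3 / 2) * ((2 * 2 : ℕ) : ℝ)) = ((c : ℝ) ^ 6)⁻¹ := by
    rw [← Real.rpow_natCast, ← Real.rpow_neg hc0.le]
    norm_num
  rw [e1, e2, e3]
  push_cast
  rw [div_eq_mul_inv, mul_inv]
  have : 0 ≤ x * (((b : ℝ) ^ 3)⁻¹ * ((c : ℝ) ^ 6)⁻¹) := by positivity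
  linarith

theorem exists_norm_twistDev_small_le :
    ∃ C : ℝ, 0 < C ∧ ∀ (q : ℕ) [Fact q.Prime] (α : (ZMod q)ˣ) (x : ℝ) (c : ℕ) (S : Finset ℕ),
      ¬ IsSquare (α : ZMod q) → 1 < x → 1 ≤ c → (∀ b ∈ S, 1 ≤ b ∧ (b : ℝ) ≤ x ^ (0.07 : ℝ)) →
      ‖twistDev α fun ℓ : (ZMod q)ˣ => ∑ b ∈ S, squareCount x q (b ^ 3 * c ^ 6) ℓ‖ ≤
        C * x ^ (0.2682 : ℝ) * (c : ℝ) ^ (-(3 / 2) : ℝ) := by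
  have hsum : Summable fun n : ℕ => (n : ℝ) ^ (-1.01 : ℝ) :=
    Real.summable_nat_rpow.2 (by norm_num)
  set T := ∑' n : ℕ, (n : ℝ) ^ (-1.01 : ℝ)
  have hT : 0 ≤ T := tsum_nonneg fun n => by positivity
  refine ⟨2 * T + 1, by positivity, ?_⟩
  intro q _ α x c S hα hx hc hS
  have hx0 : 0 < x := by linarith
  have hsplit : (fun ℓ : (ZMod q)ˣ => ∑ b ∈ S, squareCount x q (b ^ 3 * c ^ 6) ℓ) =
      ∑ b ∈ S, fun ℓ : (ZMod q)ˣ => squareCount x q (b ^ 3 * c ^ 6) ℓ := by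
    funext ℓ
    rw [Finset.sum_apply]
  rw [hsplit, map_sum]
  calc _ ≤ ∑ b ∈ S, 2 * x ^ (0.2682 : ℝ) * (c : ℝ) ^ (-(3 / 2) : ℝ) * (b : ℝ) ^ (-1.01 : ℝ) := by
        refine norm_sum_le_of_le _ fun b hb => ?_
        obtain ⟨hb1, hb2⟩ := hS b hb
        have hb0 : (0 : ℝ) < b := by exact_mod_cast hb1
        refine (norm_twistDev_squareCount_le hα hx0 hb1 hc).trans ?_
        have h1 : (b : ℝ) ^ (-(3 / 4) : ℝ) ≤ x ^ (0.0182 : ℝ) * (b : ℝ) ^ (-1.01 : ℝ) := by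
          calc (b : ℝ) ^ (-(3 / 4) : ℝ) = (b : ℝ) ^ (0.26 : ℝ) * (b : ℝ) ^ (-1.01 : ℝ) := by
                rw [← Real.rpow_add hb0]; norm_num
            _ ≤ (x ^ (0.07 : ℝ)) ^ (0.26 : ℝ) * (b : ℝ) ^ (-1.01 : ℝ) := by gcongr
            _ = _ := by rw [← Real.rpow_mul hx0.le]; norm_num
        calc _ ≤ 2 * x ^ (1 / 4 : ℝ) * (x ^ (0.0182 : ℝ) * (b : ℝ) ^ (-1.01 : ℝ)) *
              (c : ℝ) ^ (-(3 / 2) : ℝ) := by gcongr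
          _ = 2 * (x ^ (1 / 4 : ℝ) * x ^ (0.0182 : ℝ)) * (c : ℝ) ^ (-(3 / 2) : ℝ) *
              (b : ℝ) ^ (-1.01 : ℝ) := by ring
          _ = _ := by rw [← Real.rpow_add hx0]; norm_num
    _ = 2 * x ^ (0.2682 : ℝ) * (c : ℝ) ^ (-(3 / 2) : ℝ) * ∑ b ∈ S, (b : ℝ) ^ (-1.01 : ℝ) := by
        rw [Finset.mul_sum]
    _ ≤ 2 * x ^ (0.2682 : ℝ) * (c : ℝ) ^ (-(3 / 2) : ℝ) * T := by
        gcongr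
        exact hsum.sum_le_tsum S fun n _ => by positivity
    _ = 2 * T * x ^ (0.2682 : ℝ) * (c : ℝ) ^ (-(3 / 2) : ℝ) := by ring
    _ ≤ _ := by gcongr; linarith

theorem norm_twistDev_dilatedSum_le {q : ℕ} [Fact q.Prime] (α : (ZMod q)ˣ) {x : ℝ} (hx : 1 < x)
    {c : ℕ} (hc : 1 ≤ c) {p : ℝ} (hp : 1 / 2 ≤ p) :
    ‖twistDev α fun ℓ : (ZMod q)ˣ => dilatedSum x q (c ^ 6) (fun n => ((n : ℝ) ^ p)⁻¹) ℓ‖ ≤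
      4 * x ^ (1 / 4 : ℝ) * (c : ℝ) ^ (-(3 / 2) : ℝ) := by
  have hx0 : 0 < x := by linarith
  have hc0 : (0 : ℝ) < c := by exact_mod_cast hc
  by_cases hcx : (c : ℝ) ^ 6 ≤ 2 * x
  · have hle := norm_twistDev_dilatedSum_sq_le hx0 (m := c ^ 6) (by positivity) α
      (w := fun n => ((n : ℝ) ^ p)⁻¹) (fun m hm n hn hmn => by
        have : (0 : ℝ) < m := by exact_mod_cast (Set.mem_Ici.1 hm)
        have : (m : ℝ) ≤ n := by exact_mod_cast hmn
        have : 0 ≤ p := by linarith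
        dsimp only
        gcongr) (fun n => by positivity) (fun n hn => by
        have hn1 : (1 : ℝ) ≤ n := by exact_mod_cast hn
        rw [Real.sqrt_eq_rpow]
        gcongr)
    refine le_of_pow_le_pow_left₀ (n := 2) (by norm_num) (by positivity) (hle.trans ?_)
    have h1 : 1 ≤ 4 * (x ^ (1 / 2 : ℝ) * (c : ℝ) ^ (-3 : ℝ)) := by
      refine le_of_pow_le_pow_left₀ (n := 2) (by norm_num) (by positivity) ?_
      rw [mul_pow, mul_pow, ← Real.rpow_mul_natCast hx0.le, ← Real.rpow_mul_natCast hc0.le]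
      have e : (c : ℝ) ^ (-3 * ((2 : ℕ) : ℝ)) = ((c : ℝ) ^ 6)⁻¹ := by
        rw [← Real.rpow_natCast, ← Real.rpow_neg hc0.le]
        norm_num
      rw [e, ← div_eq_mul_inv]
      norm_num
      rw [mul_div_assoc', le_div_iff₀ (by positivity)]
      linarith
    rw [mul_pow, mul_pow, ← Real.rpow_mul_natCast hx0.le, ← Real.rpow_mul_natCast hc0.le]
    norm_num at h1 ⊢
    linarith
  · rw [twistDev_eq_zero, norm_zero]
    · positivity
    · refine fun ℓ => Finset.sum_eq_zero fun n hn => if_neg fun h => hcx (le_trans ?_ h.2.1)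
      exact_mod_cast Nat.le_mul_of_pos_left (c ^ 6) (Finset.mem_Icc.1 hn).1

theorem exists_norm_twistDev_Spr_le :
    ∃ C : ℝ, 0 < C ∧ ∀ (q : ℕ) [Fact q.Prime] (α : (ZMod q)ˣ) (x θ : ℝ),
      ¬ IsSquare (α : ZMod q) → 1 < x → (q : ℝ) = x ^ θ → 17 / 38 ≤ θ →
      ‖twistDev α fun ℓ : (ZMod q)ˣ => Spr x q ℓ‖ ≤
        C * x ^ ((5 * θ / 6 + 1 / 6 - 0.002) / 2) := by
  obtain ⟨C₁, hC₁, hsmall⟩ := exists_norm_twistDev_small_le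
  obtain ⟨C₂, hC₂, hlarge⟩ := exists_norm_twistDev_large_le
  have hsum : Summable fun n : ℕ => (n : ℝ) ^ (-(3 / 2) : ℝ) :=
    Real.summable_nat_rpow.2 (by norm_num)
  set T := ∑' n : ℕ, (n : ℝ) ^ (-(3 / 2) : ℝ)
  have hT : 0 ≤ T := tsum_nonneg fun n => by positivity
  set K := C₁ + C₂ + |zr (3 / 2) / 2| * 4 + |zr (2 / 3) / 3| * 4 with hK
  have hK0 : 0 < K := by positivity
  refine ⟨K * T + 1, by positivity, ?_⟩
  intro q _ α x θ hα hx hq hθ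
  have hx0 : 0 < x := by linarith
  set N := ⌊2 * x⌋₊ with hN
  have hNx : (N : ℝ) ≤ 2 * x := Nat.floor_le (by positivity)
  set e := (5 * θ / 6 + 1 / 6 - 0.002) / 2 with he
  have hmono : ∀ a, a ≤ e → x ^ a ≤ x ^ e := fun a ha =>
    Real.rpow_le_rpow_of_exponent_le hx.le ha
  have he1 : x ^ (0.2682 : ℝ) ≤ x ^ e := hmono _ (by rw [he]; linarith)
  have he2 : x ^ (1 / 4 : ℝ) ≤ x ^ e := hmono _ (by rw [he]; linarith)
  set S := (Finset.Icc 1 N).filter Squarefree with hS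
  set D := fun (c : ℕ) (p : ℝ) (ℓ : (ZMod q)ˣ) =>
    dilatedSum x q (c ^ 6) (fun n => ((n : ℝ) ^ p)⁻¹) ℓ with hD
  set L := fun (c : ℕ) (S : Finset ℕ) (ℓ : (ZMod q)ˣ) =>
    ∑ b ∈ S, squareCount x q (b ^ 3 * c ^ 6) ℓ with hL
  have hsplit : (fun ℓ : (ZMod q)ˣ => Spr x q ℓ) = ∑ c ∈ Finset.Icc 1 N,
      ((ArithmeticFunction.moebius c : ℤ) : ℝ) •
        (L c (S.filter fun b => (b : ℝ) ≤ x ^ (0.07 : ℝ)) +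
          L c (S.filter fun b => ¬ (b : ℝ) ≤ x ^ (0.07 : ℝ)) -
          (zr (3 / 2) / 2) • D c (1 / 2) - (zr (2 / 3) / 3) • D c (2 / 3)) := by
    funext ℓ
    rw [Spr_eq_sum, Finset.sum_apply]
    refine Finset.sum_congr rfl fun c _ => ?_
    simp only [Pi.smul_apply, Pi.sub_apply, Pi.add_apply, smul_eq_mul, hL, hD]
    rw [Finset.sum_filter_add_sum_filter_not]
  rw [hsplit, map_sum]
  calc _ ≤ ∑ c ∈ Finset.Icc 1 N, K * x ^ e * (c : ℝ) ^ (-(3 / 2) : ℝ) := by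
        refine norm_sum_le_of_le _ fun c hc => ?_
        have hc1 : 1 ≤ c := (Finset.mem_Icc.1 hc).1
        have hμ : |((ArithmeticFunction.moebius c : ℤ) : ℝ)| ≤ 1 := by
          exact_mod_cast ArithmeticFunction.abs_moebius_le_one
        have h1 : ‖twistDev α (L c (S.filter fun b => (b : ℝ) ≤ x ^ (0.07 : ℝ)))‖ ≤
            C₁ * x ^ e * (c : ℝ) ^ (-(3 / 2) : ℝ) := by
          refine (hsmall q α x c _ hα hx hc1 fun b hb => ?_).trans (by gcongr)
          simp only [hS, Finset.mem_filter, Finset.mem_Icc] at hb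
          exact ⟨hb.1.1.1, hb.2⟩
        have h2 : ‖twistDev α (L c (S.filter fun b => ¬ (b : ℝ) ≤ x ^ (0.07 : ℝ)))‖ ≤
            C₂ * x ^ e * (c : ℝ) ^ (-(3 / 2) : ℝ) := by
          refine hlarge q α x θ c N _ hx hq hθ hc1 hNx fun b hb => ?_
          simp only [hS, Finset.mem_filter, Finset.mem_Icc] at hb
          exact ⟨hb.1.1.1, hb.1.1.2, not_le.1 hb.2⟩
        have h3 : ∀ p : ℝ, 1 / 2 ≤ p → ‖twistDev α (D c p)‖ ≤
            4 * x ^ e * (c : ℝ) ^ (-(3 / 2) : ℝ) := fun p hp =>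
          (norm_twistDev_dilatedSum_le α hx hc1 hp).trans (by gcongr)
        rw [map_smul, norm_smul, Real.norm_eq_abs, map_sub, map_sub, map_add, map_smul, map_smul]
        calc _ ≤ 1 * (‖twistDev α (L c (S.filter fun b => (b : ℝ) ≤ x ^ (0.07 : ℝ)))‖ +
              ‖twistDev α (L c (S.filter fun b => ¬ (b : ℝ) ≤ x ^ (0.07 : ℝ)))‖ +
              ‖(zr (3 / 2) / 2) • twistDev α (D c (1 / 2))‖ +
              ‖(zr (2 / 3) / 3) • twistDev α (D c (2 / 3))‖) := by
              gcongr
              refine (norm_sub_le _ _).trans ?_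
              gcongr
              refine (norm_sub_le _ _).trans ?_
              gcongr
              exact norm_add_le _ _
          _ ≤ 1 * (C₁ * x ^ e * (c : ℝ) ^ (-(3 / 2) : ℝ) + C₂ * x ^ e * (c : ℝ) ^ (-(3 / 2) : ℝ) +
              |zr (3 / 2) / 2| * (4 * x ^ e * (c : ℝ) ^ (-(3 / 2) : ℝ)) +
              |zr (2 / 3) / 3| * (4 * x ^ e * (c : ℝ) ^ (-(3 / 2) : ℝ))) := by
              rw [norm_smul, norm_smul, Real.norm_eq_abs, Real.norm_eq_abs]
              gcongr
              · exact h3 _ le_rfl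
              · exact h3 _ (by norm_num)
          _ = _ := by rw [hK]; ring
    _ = K * x ^ e * ∑ c ∈ Finset.Icc 1 N, (c : ℝ) ^ (-(3 / 2) : ℝ) := by rw [Finset.mul_sum]
    _ ≤ K * x ^ e * T := by
        gcongr
        exact hsum.sum_le_tsum _ fun n _ => by positivity
    _ = K * T * x ^ e := by ring
    _ ≤ (K * T + 1) * x ^ e := by gcongr; linarith

end Assembly

theorem stmt18 (ε : ℝ) (hε : ε ∈ Set.Ioo (0:ℝ) (1/1000)) :
    ∃ C : ℝ, 0 < C ∧ ∀ x : ℝ, 2 ≤ x → ∀ q : ℕ, q.Prime →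
      x ^ (51/114 + ε) ≤ (q:ℝ) → (q:ℝ) ≤ x ^ (1 - ε) →
      ∀ α : ℕ, ¬ IsSquare ((α : ZMod q)) →
      (1 / (q.totient : ℝ)) *
          (∑ ℓ ∈ (Finset.range q).filter (fun ℓ => Nat.Coprime ℓ q),
            |(1/2) * (Spr x q ((ℓ : ℕ) : ZMod q) + Spr x q ((α * ℓ : ℕ) : ZMod q)) -
              (1 / (q.totient : ℝ)) * SprCop x q| ^ 2)
      ≤ C * (x/(q:ℝ)) ^ ((1:ℝ)/6 - ε/16) := by
  obtain ⟨C, hC, hmain⟩ := exists_norm_twistDev_Spr_le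
  refine ⟨2 * C ^ 2, by positivity, ?_⟩
  intro x hx q hqp hq1 hq2 α hα
  obtain ⟨hε0, hε1⟩ := hε
  have hx0 : 0 < x := by linarith
  have hx1 : 1 < x := by linarith
  have : Fact q.Prime := ⟨hqp⟩
  have hq0 : (0 : ℝ) < q := by exact_mod_cast hqp.pos
  have hα0 : (α : ZMod q) ≠ 0 := by
    intro h
    exact hα (h ▸ IsSquare.zero)
  set u : (ZMod q)ˣ := Units.mk0 (α : ZMod q) hα0
  set θ := Real.logb x q with hθ
  have hqθ : (q : ℝ) = x ^ θ := (Real.rpow_logb hx0 hx1.ne' hq0).symm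
  have hθ1 : 51 / 114 + ε ≤ θ := (Real.le_logb_iff_rpow_le hx1 hq0).2 hq1
  have hθ2 : θ ≤ 1 - ε := (Real.logb_le_iff_le_rpow hx1 hq0).2 hq2
  rw [mean_square_deviation_eq x (u := u) rfl]
  have hnorm := hmain q u x θ hα hx1 hqθ (by linarith)
  have hφ : x ^ θ / 2 ≤ (q.totient : ℝ) := by
    rw [← hqθ, Nat.totient_prime hqp, Nat.cast_sub hqp.one_le]
    have : (2 : ℝ) ≤ q := by exact_mod_cast hqp.two_le
    push_cast
    linarith
  have hpos : 0 < x ^ θ / 2 := by positivity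
  calc 1 / (q.totient : ℝ) * ‖twistDev u fun t : (ZMod q)ˣ => Spr x q t‖ ^ 2
      ≤ 1 / (x ^ θ / 2) * (C * x ^ ((5 * θ / 6 + 1 / 6 - 0.002) / 2)) ^ 2 := by gcongr
    _ = 2 * C ^ 2 * (x ^ (5 * θ / 6 + 1 / 6 - 0.002) / x ^ θ) := by
        rw [mul_pow, ← Real.rpow_mul_natCast hx0.le]
        push_cast
        rw [div_mul_cancel₀ _ (two_ne_zero)]
        ring
    _ = 2 * C ^ 2 * x ^ (5 * θ / 6 + 1 / 6 - 0.002 - θ) := by rw [← Real.rpow_sub hx0]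
    _ ≤ 2 * C ^ 2 * x ^ ((1 - θ) * (1 / 6 - ε / 16)) := by
        gcongr
        · exact hx1.le
        · nlinarith
    _ = 2 * C ^ 2 * (x / q) ^ ((1 : ℝ) / 6 - ε / 16) := by
        rw [hqθ, Real.rpow_mul hx0.le, Real.rpow_sub hx0, Real.rpow_one]
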